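/- arXiv:math/9812111 — 3 statements merged into one kernel-verified Lean document; each statement's English description precedes it below -/
import Mathlib

section
/- Let a ≥ 0 and let (f_n) be a sequence of functions in L^+ with f_n ∈ A_a for every n. Suppose f_n converges uniformly on every compact subset of ℂ to a function f ∈ A_a which does not vanish identically. Then the sequence (f_n) is bounded in A_a (for every b > a, sup_n ‖f_n‖_b < ∞), ‖f_n − f‖_b → 0 for every b > a, and f ∈ L^+. -/
open Filter Topology
open scoped ENNReal

/-- The norm `‖f‖_b = sup_{k} b^{-k} |f^{(k)}(0)|`, valued in `ℝ≥0∞`. -/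
noncomputable def normB (b : ℝ) (f : ℂ → ℂ) : ℝ≥0∞ :=
  ⨆ k : ℕ, ENNReal.ofReal (‖iteratedDeriv k f 0‖ / b ^ k)

/-- `f ∈ A_a`: `f` is entire and `‖f‖_b < ∞` for every `b > a`. -/
def InA (a : ℝ) (f : ℂ → ℂ) : Prop :=
  Differentiable ℂ f ∧ ∀ b > a, normB b f < ⊤

/-- The Laguerre class `L⁺`: `f(z) = C z^l e^{αz} ∏_{j} (1 + β_j z)` with `α ≥ 0` and
`(β_j)` a nonincreasing summable sequence of nonnegative reals. -/
def LaguerrePlus (f : ℂ → ℂ) : Prop :=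
  ∃ (C : ℂ) (l : ℕ) (α : ℝ) (β : ℕ → ℝ),
    0 ≤ α ∧ (∀ j, 0 ≤ β j) ∧ (∀ j, β (j + 1) ≤ β j) ∧ Summable β ∧
    ∀ z : ℂ, f z = C * z ^ l * Complex.exp ((α : ℂ) * z) * ∏' j : ℕ, (1 + (β j : ℂ) * z)

def TP (f : ℂ → ℂ) : Prop := Differentiable ℂ f ∧ ∃ r : ℕ → ℝ, (∀ k, 0 ≤ r k) ∧
  (∀ i j, i ≤ j → r i * r (j + 1) ≤ r (i + 1) * r j) ∧ ∀ k, iteratedDeriv k f 0 = (r k : ℂ)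

lemma TP_lim {F : ℕ → ℂ → ℂ} {f : ℂ → ℂ} (hF : ∀ n, TP (F n)) (hf : Differentiable ℂ f)
    (h : ∀ k, Tendsto (fun n => iteratedDeriv k (F n) 0) atTop (𝓝 (iteratedDeriv k f 0))) :
    TP f := by
  choose r hr using fun n => (hF n).2
  choose hr0 hr1 hr2 using hr
  have hre : ∀ k, Tendsto (fun n => r n k) atTop (𝓝 (iteratedDeriv k f 0).re) := by
    intro k
    have := (Complex.continuous_re.tendsto _).comp (h k)
    refine this.congr fun n => ?_
    simp [hr2]
  have him : ∀ k, (iteratedDeriv k f 0).im = 0 := by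
    intro k
    have := (Complex.continuous_im.tendsto _).comp (h k)
    refine tendsto_nhds_unique this ?_
    refine tendsto_const_nhds.congr fun n => ?_
    simp [hr2]
  refine ⟨hf, fun k => (iteratedDeriv k f 0).re, fun k => ge_of_tendsto' (hre k) fun n => hr0 n k,
    fun i j hij => le_of_tendsto_of_tendsto' ((hre i).mul (hre (j+1))) ((hre (i+1)).mul (hre j))
      fun n => hr1 n i j hij, fun k => ?_⟩
  apply Complex.ext <;> simp [him]

lemma iteratedDeriv_lin_mul (p q : ℂ) (f : ℂ → ℂ) (hf : Differentiable ℂ f) (k : ℕ) :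
    iteratedDeriv (k + 1) (fun z => (p + q * z) * f z) =
      fun z => (p + q * z) * iteratedDeriv (k + 1) f z + q * (k + 1) * iteratedDeriv k f z := by
  have hd : ∀ k z, HasDerivAt (iteratedDeriv k f) (iteratedDeriv (k+1) f z) z := by
    intro k z
    rw [iteratedDeriv_succ]
    have : ContDiff ℂ (⊤ : ℕ∞) f := hf.contDiff
    exact ((this.differentiable_iteratedDeriv k (by exact_mod_cast ENat.natCast_lt_top k)) z).hasDerivAt
  have hl : ∀ z, HasDerivAt (fun z : ℂ => p + q * z) q z := by
    intro z
    simpa using ((hasDerivAt_id z).const_mul q).const_add p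
  induction k with
  | zero =>
    funext z
    rw [zero_add, iteratedDeriv_one]
    have := ((hl z).mul (hd 0 z)).deriv
    simp only [iteratedDeriv_zero, zero_add] at this
    rw [show (fun z => (p + q * z) * f z) = (fun z => (p + q * z)) * f from rfl, this]
    simp
    ring
  | succ k ih =>
    funext z
    rw [iteratedDeriv_succ, ih]
    have := (((hl z).mul (hd (k+1) z)).add ((hd k z).const_mul (q * (k+1)))).deriv
    refine Eq.trans this ?_
    push_cast
    ring

lemma TP_lin_mul {f : ℂ → ℂ} (hf : TP f) (p q : ℝ) (hp : 0 ≤ p) (hq : 0 ≤ q) :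
    TP (fun z => ((p : ℂ) + q * z) * f z) := by
  obtain ⟨hd, r, r0, r1, r2⟩ := hf
  refine ⟨by fun_prop, fun k => p * r k + q * (k * r (k - 1)), fun k => ?_, ?_, ?_⟩
  · have := r0 k
    have := r0 (k-1)
    positivity
  · have key0 : ∀ j : ℕ, (j:ℝ) * (r 0 * r j) ≤ j * (r 1 * r (j - 1)) := by
      intro j
      rcases j with _ | j
      · simp
      · exact mul_le_mul_of_nonneg_left (by simpa using r1 0 j (by omega)) (by positivity)
    intro i j hij
    have hA := r1 i j hij
    -- second order
    have hB : (i:ℝ) * r (i-1) * ((j+1 : ℝ) * r j) ≤ ((i:ℝ)+1) * r i * (j * r (j-1)) := by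
      rcases i with _ | i
      · have := r0 0
        have := r0 (j-1)
        simp
        positivity
      · rcases j with _ | j
        · omega
        · have h := r1 i j (by omega)
          have hij' : (i:ℝ) ≤ j := by exact_mod_cast (by omega : i ≤ j)
          have h1 := mul_nonneg (r0 i) (r0 (j+1))
          simp only [Nat.add_sub_cancel]
          push_cast
          have e : ((i:ℝ)+1) * ((j:ℝ)+1+1) ≤ ((i:ℝ)+1+1) * ((j:ℝ)+1) := by nlinarith
          calc _ = (((i:ℝ)+1) * ((j:ℝ)+1+1)) * (r i * r (j+1)) := by ring
            _ ≤ (((i:ℝ)+1+1) * ((j:ℝ)+1)) * (r (i+1) * r j) :=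
              mul_le_mul e h h1 (by positivity)
            _ = _ := by ring
    have hC : r i * ((j+1:ℝ) * r j) + i * r (i-1) * r (j+1)
        ≤ r (i+1) * (j * r (j-1)) + ((i:ℝ)+1) * r i * r j := by
      rcases eq_or_lt_of_le hij with rfl | hlt
      · apply le_of_eq; ring
      · obtain ⟨j, rfl⟩ : ∃ m, j = m + 1 := ⟨j - 1, by omega⟩
        have hX := r1 i j (by omega)
        have hij' : (i:ℝ) ≤ j := by exact_mod_cast (by omega : i ≤ j)
        have hY : (i:ℝ) * (r (i-1) * r (j+1+1)) ≤ i * (r i * r (j+1)) := by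
          rcases i with _ | i
          · simp
          · exact mul_le_mul_of_nonneg_left (by simpa using r1 i (j+1) (by omega)) (by positivity)
        simp only [Nat.add_sub_cancel]
        push_cast
        nlinarith [mul_le_mul_of_nonneg_left hX (by positivity : (0:ℝ) ≤ (j:ℝ)+1)]
    simp only [Nat.add_sub_cancel]
    push_cast
    nlinarith [mul_le_mul_of_nonneg_left hA (mul_nonneg hp hp),
      mul_le_mul_of_nonneg_left hB (mul_nonneg hq hq),
      mul_le_mul_of_nonneg_left hC (mul_nonneg hp hq)]
  · intro k
    rcases k with _ | k
    · have := r2 0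
      simp at this
      simp [this]
    · rw [iteratedDeriv_lin_mul _ _ _ hd]
      simp only [r2]
      simp
      ring

lemma TP_exp (α : ℝ) (hα : 0 ≤ α) : TP (fun z => Complex.exp (α * z)) := by
  refine ⟨by fun_prop, fun k => α ^ k, fun k => by positivity, fun i j _ => le_of_eq (by ring), ?_⟩
  intro k
  simp [iteratedDeriv_cexp_const_mul]

lemma TP_pow_mul {f : ℂ → ℂ} (hf : TP f) (l : ℕ) : TP (fun z => z ^ l * f z) := by
  induction l with
  | zero => simpa using hf
  | succ l ih =>
    have := TP_lin_mul ih 0 1 le_rfl zero_le_one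
    convert this using 2
    push_cast; ring

lemma TP_prod_mul {f : ℂ → ℂ} (hf : TP f) (β : ℕ → ℝ) (hβ : ∀ j, 0 ≤ β j) (n : ℕ) :
    TP (fun z => (∏ j ∈ Finset.range n, (1 + (β j : ℂ) * z)) * f z) := by
  induction n with
  | zero => simpa using hf
  | succ n ih =>
    have := TP_lin_mul ih 1 (β n) zero_le_one (hβ n)
    convert this using 2
    rw [Finset.prod_range_succ]
    push_cast; ring

lemma tendsto_iteratedDeriv {F : ℕ → ℂ → ℂ} {f : ℂ → ℂ}
    (hF : ∀ n, Differentiable ℂ (F n))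
    (h : TendstoLocallyUniformlyOn F f atTop Set.univ) (k : ℕ) :
    Tendsto (fun n => iteratedDeriv k (F n) 0) atTop (𝓝 (iteratedDeriv k f 0)) := by
  have : ∀ k, TendstoLocallyUniformlyOn (fun n => iteratedDeriv k (F n)) (iteratedDeriv k f) atTop
      Set.univ := by
    intro k
    induction k with
    | zero => simpa using h
    | succ k ih =>
      have := ih.deriv (.of_forall fun n => ?_) isOpen_univ
      · simp only [iteratedDeriv_succ]
        exact this
      · have h1 : ContDiff ℂ (⊤ : ℕ∞) (F n) := (hF n).contDiff
        exact (h1.differentiable_iteratedDeriv k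
          (by exact_mod_cast ENat.natCast_lt_top k)).differentiableOn
  exact (this k).tendsto_at (Set.mem_univ _)

lemma prod_locunif (β : ℕ → ℝ) (hβ : ∀ j, 0 ≤ β j) (hs : Summable β) :
    TendstoLocallyUniformlyOn (fun n (z : ℂ) => ∏ j ∈ Finset.range n, (1 + (β j : ℂ) * z))
      (fun z => ∏' j, (1 + (β j : ℂ) * z)) atTop Set.univ := by
  rw [tendstoLocallyUniformlyOn_iff_forall_isCompact isOpen_univ]
  intro K _ hK
  obtain ⟨R, hR⟩ := hK.isBounded.exists_norm_le
  have := Summable.hasProdUniformlyOn_nat_one_add (f := fun j (z : ℂ) => (β j : ℂ) * z) hK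
    (hs.mul_right R) (.of_forall fun n z hz => ?_) (fun n => by fun_prop)
  · exact this.tendstoUniformlyOn_finsetRange
  · rw [norm_mul, Complex.norm_real, Real.norm_of_nonneg (hβ n)]
    exact mul_le_mul_of_nonneg_left (hR z hz) (hβ n)

lemma prod_diff (β : ℕ → ℝ) (hβ : ∀ j, 0 ≤ β j) (hs : Summable β) :
    Differentiable ℂ (fun z : ℂ => ∏' j, (1 + (β j : ℂ) * z)) := by
  have := (prod_locunif β hβ hs).differentiableOn (.of_forall fun n => by fun_prop) isOpen_univ
  exact differentiableOn_univ.1 this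

lemma TP_laguerre {f : ℂ → ℂ} (hf : LaguerrePlus f) : ∃ (C : ℂ) (h : ℂ → ℂ), TP h ∧
    f = fun z => C * h z := by
  obtain ⟨C, l, α, β, hα, hβ, -, hs, hz⟩ := hf
  have h0 := TP_pow_mul (TP_exp α hα) l
  refine ⟨C, fun z => (∏' j, (1 + (β j : ℂ) * z)) * (z ^ l * Complex.exp (α * z)), ?_, ?_⟩
  · have hP := prod_diff β hβ hs
    refine TP_lim (fun n => TP_prod_mul h0 β hβ n) (hP.mul h0.1) ?_
    intro k
    have e : ∀ G : ℂ → ℂ, Differentiable ℂ G →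
      iteratedDeriv k (fun z => G z * (z ^ l * Complex.exp (α * z))) 0 =
        ∑ i ∈ .range (k + 1), k.choose i * iteratedDeriv i G 0 *
          iteratedDeriv (k - i) (fun z => z ^ l * Complex.exp (α * z)) 0 := fun G hG =>
      iteratedDeriv_fun_mul hG.contDiff.contDiffAt h0.1.contDiff.contDiffAt
    rw [e _ hP]
    have hfin : ∀ n, Differentiable ℂ
        (fun z : ℂ => ∏ j ∈ Finset.range n, (1 + (β j : ℂ) * z)) := fun n => by fun_prop
    simp_rw [fun n => e _ (hfin n)]
    refine tendsto_finsetSum _ fun i _ => ?_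
    exact ((tendsto_iteratedDeriv hfin (prod_locunif β hβ hs) i).const_mul _).mul_const _
  · funext z
    rw [hz]; ring

lemma laguerre_ineq {f : ℂ → ℂ} (hf : LaguerrePlus f) (i j : ℕ) (hij : i ≤ j) :
    ‖iteratedDeriv i f 0‖ * ‖iteratedDeriv (j + 1) f 0‖ ≤
      ‖iteratedDeriv (i + 1) f 0‖ * ‖iteratedDeriv j f 0‖ := by
  obtain ⟨C, h, ⟨hd, r, r0, r1, r2⟩, rfl⟩ := TP_laguerre hf
  have e : ∀ k, ‖iteratedDeriv k (fun z => C * h z) 0‖ = ‖C‖ * r k := by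
    intro k
    rw [iteratedDeriv_const_mul_field, r2, norm_mul, Complex.norm_real, Real.norm_of_nonneg (r0 k)]
  simp only [e]
  nlinarith [mul_le_mul_of_nonneg_left (r1 i j hij) (mul_nonneg (norm_nonneg C) (norm_nonneg C))]

lemma laguerre_coeff_le {f : ℂ → ℂ} (hf : LaguerrePlus f) (k : ℕ) :
    ‖iteratedDeriv k f 0‖ / k.factorial ≤ ‖f 1‖ := by
  obtain ⟨C, h, ⟨hd, r, r0, r1, r2⟩, rfl⟩ := TP_laguerre hf
  rw [iteratedDeriv_const_mul_field, r2, norm_mul, norm_mul, mul_div_assoc]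
  refine mul_le_mul_of_nonneg_left ?_ (norm_nonneg C)
  rw [Complex.norm_real, Real.norm_of_nonneg (r0 k)]
  have hs := Complex.hasSum_re (Complex.hasSum_taylorSeries_of_entire hd 0 1)
  have hs' : HasSum (fun n : ℕ => r n / n.factorial) (h 1).re := by
    convert hs using 2 with n
    rw [r2]
    simp only [sub_zero, one_pow, one_mul, smul_eq_mul]
    rw [← Complex.ofReal_natCast, ← Complex.ofReal_inv, ← Complex.ofReal_mul, Complex.ofReal_re]
    ring
  refine le_trans (le_hasSum hs' k fun j _ => div_nonneg (r0 j) (by positivity)) ?_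
  exact (le_abs_self _).trans (Complex.abs_re_le_norm _)

lemma normB_le {b M : ℝ} (hb : 0 < b) {f : ℂ → ℂ}
    (h : ∀ k, ‖iteratedDeriv k f 0‖ ≤ M * b ^ k) : normB b f ≤ ENNReal.ofReal M := by
  refine iSup_le fun k => ENNReal.ofReal_le_ofReal ?_
  rw [div_le_iff₀ (by positivity)]
  exact h k

lemma normB_lt_top {b : ℝ} (hb : 0 < b) {f : ℂ → ℂ} (h : normB b f < ⊤) :
    ∃ M, 0 ≤ M ∧ ∀ k, ‖iteratedDeriv k f 0‖ ≤ M * b ^ k := by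
  refine ⟨(normB b f).toReal, ENNReal.toReal_nonneg, fun k => ?_⟩
  rw [← div_le_iff₀ (by positivity)]
  have h1 : ENNReal.ofReal (‖iteratedDeriv k f 0‖ / b ^ k) ≤ normB b f :=
    le_iSup (fun k => ENNReal.ofReal (‖iteratedDeriv k f 0‖ / b ^ k)) k
  exact (ENNReal.ofReal_le_iff_le_toReal h.ne).1 h1

lemma exists_coeff_ne {g : ℂ → ℂ} (hd : Differentiable ℂ g) (hg0 : ∃ z, g z ≠ 0) :
    ∃ k, iteratedDeriv k g 0 ≠ 0 := by
  by_contra! hc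
  obtain ⟨z, hz⟩ := hg0
  have := Complex.hasSum_taylorSeries_of_entire hd 0 z
  simp only [hc, smul_zero] at this
  exact hz (this.unique hasSum_zero)

lemma unif_bound (a : ℝ) (ha : 0 ≤ a) (f : ℕ → ℂ → ℂ) (g : ℂ → ℂ)
    (hL : ∀ n, LaguerrePlus (f n))
    (hgA : InA a g) (hg0 : ∃ z, g z ≠ 0)
    (hc : ∀ k, Tendsto (fun n => iteratedDeriv k (f n) 0) atTop (𝓝 (iteratedDeriv k g 0)))
    (b : ℝ) (hb : a < b) :
    ∃ M, 0 ≤ M ∧ ∀ᶠ n in atTop, ∀ k, ‖iteratedDeriv k (f n) 0‖ ≤ M * b ^ k := by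
  have hb0 : 0 < b := ha.trans_lt hb
  obtain ⟨k1, hk1⟩ := exists_coeff_ne hgA.1 hg0
  have hex : ∃ k0, ‖iteratedDeriv (k0+1) g 0‖ < b * ‖iteratedDeriv k0 g 0‖ := by
    by_contra! hcon
    obtain ⟨M, hM0, hM⟩ := normB_lt_top (b := (a+b)/2) (by linarith) (hgA.2 _ (by linarith))
    have hgrow : ∀ m, b ^ m * ‖iteratedDeriv k1 g 0‖ ≤ ‖iteratedDeriv (k1+m) g 0‖ := by
      intro m
      induction m with
      | zero => simp
      | succ m ih =>
        refine le_trans ?_ (hcon (k1+m))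
        rw [pow_succ]
        nlinarith
    have hb' : 0 < (a+b)/2 := by linarith
    have hD : 0 < ‖iteratedDeriv k1 g 0‖ := norm_pos_iff.2 hk1
    have hq : Tendsto (fun m : ℕ => (M * ((a+b)/2)^k1) * (((a+b)/2)/b)^m) atTop
        (𝓝 ((M * ((a+b)/2)^k1) * 0)) :=
      (tendsto_pow_atTop_nhds_zero_of_lt_one (by positivity)
        (by rw [div_lt_one hb0]; linarith)).const_mul _
    have hle : ‖iteratedDeriv k1 g 0‖ ≤ (M * ((a+b)/2)^k1) * 0 := by
      refine ge_of_tendsto' hq fun m => ?_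
      have := (hgrow m).trans (hM (k1+m))
      rw [div_pow _ b m, ← mul_div_assoc, le_div_iff₀ (by positivity)]
      rw [pow_add] at this
      linarith
    linarith
  obtain ⟨k0, hk0⟩ := hex
  have hev : ∀ᶠ n in atTop, ‖iteratedDeriv (k0+1) (f n) 0‖ < b * ‖iteratedDeriv k0 (f n) 0‖ :=
    (hc (k0+1)).norm.eventually_lt ((hc k0).norm.const_mul b) hk0
  have hev2 : ∀ᶠ n in atTop, ∀ k ∈ Finset.range (k0+1),
      ‖iteratedDeriv k (f n) 0‖ < ‖iteratedDeriv k g 0‖ + 1 := by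
    rw [Finset.eventually_all]
    intro k _
    exact (hc k).norm.eventually_lt_const (by linarith)
  set M := ∑ k ∈ Finset.range (k0+1), (‖iteratedDeriv k g 0‖ + 1) / b ^ k with hMdef
  have hMk : ∀ k ∈ Finset.range (k0+1), (‖iteratedDeriv k g 0‖ + 1) ≤ M * b ^ k := by
    intro k hk
    rw [← div_le_iff₀ (by positivity)]
    exact Finset.single_le_sum (f := fun k => (‖iteratedDeriv k g 0‖ + 1) / b ^ k)
      (fun i _ => by positivity) hk
  refine ⟨M, Finset.sum_nonneg fun i _ => by positivity, ?_⟩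
  filter_upwards [hev, hev2] with n h1 h2 k
  rcases Nat.lt_or_ge k (k0+1) with hk | hk
  · have hk' := Finset.mem_range.2 hk
    exact (h2 k hk').le.trans (hMk k hk')
  · obtain ⟨m, rfl⟩ : ∃ m, k = k0 + m := ⟨k - k0, by omega⟩
    clear hk
    have hpos : 0 < ‖iteratedDeriv k0 (f n) 0‖ := by
      have := norm_nonneg (iteratedDeriv (k0+1) (f n) 0)
      by_contra! hh
      nlinarith
    induction m with
    | zero =>
      have hk' := Finset.mem_range.2 (Nat.lt_succ_self k0)
      exact (h2 k0 hk').le.trans (hMk k0 hk')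
    | succ m ih =>
      have := laguerre_ineq (hL n) k0 (k0+m) (by omega)
      have hstep : ‖iteratedDeriv (k0+m+1) (f n) 0‖ ≤ b * ‖iteratedDeriv (k0+m) (f n) 0‖ := by
        refine le_of_mul_le_mul_left ?_ hpos
        refine this.trans ?_
        nlinarith [mul_le_mul_of_nonneg_right h1.le (norm_nonneg (iteratedDeriv (k0+m) (f n) 0))]
      refine hstep.trans ?_
      rw [← add_assoc, pow_succ]
      nlinarith [mul_le_mul_of_nonneg_left ih hb0.le]

lemma part12 (a : ℝ) (ha : 0 ≤ a) (f : ℕ → ℂ → ℂ) (g : ℂ → ℂ)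
    (hL : ∀ n, LaguerrePlus (f n)) (hA : ∀ n, InA a (f n))
    (hgA : InA a g) (hg0 : ∃ z, g z ≠ 0)
    (hc : ∀ k, Tendsto (fun n => iteratedDeriv k (f n) 0) atTop (𝓝 (iteratedDeriv k g 0))) :
    (∀ b > a, (⨆ n, normB b (f n)) < ⊤) ∧
    (∀ b > a, Tendsto (fun n => normB b (f n - g)) atTop (nhds 0)) := by
  have hU := unif_bound a ha f g hL hgA hg0 hc
  constructor
  · intro b hb
    have hb0 : 0 < b := ha.trans_lt hb
    obtain ⟨M, hM0, hM⟩ := hU b hb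
    obtain ⟨N, hN⟩ := eventually_atTop.1 hM
    have : (⨆ n, normB b (f n)) ≤ ENNReal.ofReal M + ∑ n ∈ Finset.range N, normB b (f n) := by
      refine iSup_le fun n => ?_
      rcases Nat.lt_or_ge n N with hn | hn
      · exact le_add_left (Finset.single_le_sum (f := fun n => normB b (f n))
          (fun _ _ => zero_le) (Finset.mem_range.2 hn))
      · exact le_add_right (normB_le hb0 (hN n hn))
    refine this.trans_lt (ENNReal.add_lt_top.2 ⟨ENNReal.ofReal_lt_top, ?_⟩)
    exact ENNReal.sum_lt_top.2 fun n _ => (hA n).2 b hb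
  · intro b hb
    have hb0 : 0 < b := ha.trans_lt hb
    set b' := (a+b)/2 with hb'
    have hb'0 : 0 < b' := by linarith
    have hb'b : b' < b := by linarith
    obtain ⟨M, hM0, hM⟩ := hU b' (by linarith)
    obtain ⟨M', hM'0, hM'⟩ := normB_lt_top (b := b') hb'0 (hgA.2 _ (by linarith))
    have hsub : ∀ n k, iteratedDeriv k (f n - g) 0 = iteratedDeriv k (f n) 0 - iteratedDeriv k g 0 :=
      fun n k => iteratedDeriv_sub (hA n).1.contDiff.contDiffAt hgA.1.contDiff.contDiffAt
    suffices H : ∀ ε : ℝ, 0 < ε → ∀ᶠ n in atTop, normB b (f n - g) ≤ ENNReal.ofReal ε by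
      rw [ENNReal.tendsto_nhds_zero]
      intro ε hε
      obtain ⟨δ, hδ, hδε⟩ : ∃ δ : ℝ, 0 < δ ∧ ENNReal.ofReal δ ≤ ε := by
        rcases eq_or_ne ε ⊤ with rfl | hne
        · exact ⟨1, one_pos, le_top⟩
        · exact ⟨ε.toReal, ENNReal.toReal_pos hε.ne' hne, ENNReal.ofReal_toReal_le⟩
      exact (H δ hδ).mono fun n hn => hn.trans hδε
    intro ε hε
    have hq : Tendsto (fun m : ℕ => (M + M') * (b'/b)^m) atTop (𝓝 ((M + M') * 0)) :=
      (tendsto_pow_atTop_nhds_zero_of_lt_one (by positivity)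
        (by rw [div_lt_one hb0]; linarith)).const_mul _
    rw [mul_zero] at hq
    obtain ⟨K, hK⟩ := eventually_atTop.1 (hq.eventually_lt_const hε)
    have hev2 : ∀ᶠ n in atTop, ∀ k ∈ Finset.range K,
        ‖iteratedDeriv k (f n - g) 0‖ < ε * b ^ k := by
      rw [Finset.eventually_all]
      intro k _
      have : Tendsto (fun n => ‖iteratedDeriv k (f n - g) 0‖) atTop (𝓝 0) := by
        simp only [hsub]
        exact tendsto_iff_norm_sub_tendsto_zero.1 (hc k)
      exact this.eventually_lt_const (by positivity)
    filter_upwards [hM, hev2] with n h1 h2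
    refine normB_le hb0 fun k => ?_
    rcases Nat.lt_or_ge k K with hk | hk
    · exact (h2 k (Finset.mem_range.2 hk)).le
    · have h3 := hK k hk
      rw [hsub]
      refine (norm_sub_le _ _).trans ?_
      rw [div_pow, ← mul_div_assoc, div_lt_iff₀ (by positivity)] at h3
      linarith [h1 k, hM' k]

def Sh (f : ℂ → ℂ) : Prop := ∃ (D : ℂ) (α : ℝ) (γ : ℕ → ℝ), 0 ≤ α ∧ (∀ j, 0 ≤ γ j) ∧
  (∀ j, γ j ≤ 1) ∧ (∀ j, γ (j + 1) ≤ γ j) ∧ Summable γ ∧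
  ∀ z : ℂ, f z = D * Complex.exp ((α : ℂ) * (z - 1)) * ∏' j, (1 + (γ j : ℂ) * (z - 1))

lemma mult_aux {γ : ℕ → ℝ} (hs : Summable γ) (w : ℂ) :
    Multipliable (fun j => 1 + (γ j : ℂ) * w) :=
  Complex.multipliable_one_add_of_summable ((Complex.summable_ofReal.2 hs).mul_right w)

lemma sh_of_laguerre {f : ℂ → ℂ} (hf : LaguerrePlus f) : Sh f := by
  obtain ⟨C, l, α, β, hα, hβ, hm, hs, hz⟩ := hf
  set δ : ℕ → ℝ := fun j => β j / (1 + β j) with hδ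
  have hpos : ∀ j, 0 < 1 + β j := fun j => by linarith [hβ j]
  have δ0 : ∀ j, 0 ≤ δ j := fun j => div_nonneg (hβ j) (hpos j).le
  have δ1 : ∀ j, δ j ≤ 1 := fun j => by
    rw [hδ]; simp only; rw [div_le_one (hpos j)]; linarith
  have δs : Summable δ := by
    refine hs.of_nonneg_of_le δ0 fun j => ?_
    exact div_le_self (hβ j) (by linarith [hβ j])
  set γ : ℕ → ℝ := fun j => if j < l then 1 else δ (j - l) with hγ
  have hshift : ∀ j, γ (j + l) = δ j := fun j => by simp [hγ]
  have hlt : ∀ j ∈ Finset.range l, γ j = 1 := fun j hj => by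
    have := Finset.mem_range.1 hj
    simp [hγ, this]
  have γs : Summable γ := by
    rw [← summable_nat_add_iff l]
    simpa only [hshift] using δs
  refine ⟨C * Complex.exp α * ∏' j, (1 + (β j : ℂ) * 1), α, γ, hα, ?_, ?_, ?_, γs, ?_⟩
  · intro j; simp only [hγ]; split_ifs
    · exact zero_le_one
    · exact δ0 _
  · intro j; simp only [hγ]; split_ifs
    · exact le_rfl
    · exact δ1 _
  · intro j
    simp only [hγ]
    split_ifs with h1 h2 h2
    · exact le_rfl
    · omega
    · exact δ1 _
    · rw [show j + 1 - l = (j - l) + 1 by omega]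
      simp only [hδ]
      rw [div_le_div_iff₀ (hpos _) (hpos _)]
      nlinarith [hm (j - l)]
  · intro z
    have hmul : Multipliable (fun j => 1 + (γ (j + l) : ℂ) * (z - 1)) := by
      simp only [hshift]
      exact mult_aux δs _
    rw [← hmul.prod_mul_tprod_nat_mul' (f := fun j => 1 + (γ j : ℂ) * (z - 1))]
    have e1 : ∏ j ∈ Finset.range l, (1 + (γ j : ℂ) * (z - 1)) = z ^ l := by
      rw [Finset.prod_congr rfl (g := fun _ => z)]
      · simp
      · intro j hj
        rw [hlt j hj]; simp
    rw [e1]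
    simp only [hshift]
    have e2 : (∏' j, (1 + (β j : ℂ) * 1)) * ∏' j, (1 + (δ j : ℂ) * (z - 1)) =
        ∏' j, (1 + (β j : ℂ) * z) := by
      rw [← (mult_aux hs 1).tprod_mul (mult_aux δs (z - 1))]
      refine tprod_congr fun j => ?_
      have : (1 + (β j : ℂ)) ≠ 0 := by exact_mod_cast (hpos j).ne'
      simp only [hδ]
      push_cast
      field_simp
      ring
    rw [hz, ← e2, show (α : ℂ) * z = α + α * (z - 1) by ring, Complex.exp_add]
    ring

lemma laguerre_of_sh {f : ℂ → ℂ} (hf : Sh f) : LaguerrePlus f := by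
  obtain ⟨D, α, γ, hα, γ0, γ1, hm, hs, hz⟩ := hf
  have hanti : Antitone γ := antitone_nat_of_succ_le hm
  have hex : ∃ j, γ j < 1 := (hs.tendsto_atTop_zero.eventually_lt_const zero_lt_one).exists
  classical
  set l := Nat.find hex with hl
  have hl1 : γ l < 1 := Nat.find_spec hex
  have hlt : ∀ j ∈ Finset.range l, γ j = 1 := fun j hj =>
    le_antisymm (γ1 j) (not_lt.1 (Nat.find_min hex (Finset.mem_range.1 hj)))
  have hlj : ∀ j, γ (j + l) ≤ γ l := fun j => hanti (by omega)
  have hpos : ∀ j, 0 < 1 - γ (j + l) := fun j => by linarith [hlj j]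
  have hs' : Summable (fun j => γ (j + l)) := (summable_nat_add_iff l).2 hs
  set β : ℕ → ℝ := fun j => γ (j + l) / (1 - γ (j + l)) with hβ
  have β0 : ∀ j, 0 ≤ β j := fun j => div_nonneg (γ0 _) (hpos j).le
  have βs : Summable β := by
    refine (hs'.div_const (1 - γ l)).of_nonneg_of_le β0 fun j => ?_
    exact div_le_div_of_nonneg_left (γ0 _) (by linarith) (by linarith [hlj j])
  refine ⟨D * Complex.exp (-α) * ∏' j, (1 + (γ (j + l) : ℂ) * (-1)), l, α, β, hα, β0, ?_, βs, ?_⟩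
  · intro j
    simp only [hβ]
    rw [div_le_div_iff₀ (hpos _) (hpos _)]
    have := hm (j + l)
    rw [show j + 1 + l = j + l + 1 by omega]
    nlinarith
  · intro z
    rw [hz, ← (mult_aux hs' (z - 1)).prod_mul_tprod_nat_mul' (f := fun j => 1 + (γ j : ℂ) * (z - 1))]
    have e1 : ∏ j ∈ Finset.range l, (1 + (γ j : ℂ) * (z - 1)) = z ^ l := by
      rw [Finset.prod_congr rfl (g := fun _ => z)]
      · simp
      · intro j hj
        rw [hlt j hj]; simp
    have e2 : (∏' j, (1 + (γ (j + l) : ℂ) * (-1))) * ∏' j, (1 + (β j : ℂ) * z) =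
        ∏' j, (1 + (γ (j + l) : ℂ) * (z - 1)) := by
      rw [← (mult_aux hs' (-1)).tprod_mul (mult_aux βs z)]
      refine tprod_congr fun j => ?_
      have : (1 - (γ (j + l) : ℂ)) ≠ 0 := by exact_mod_cast (hpos j).ne'
      simp only [hβ]
      push_cast
      field_simp
      ring
    rw [e1, ← e2, show (α : ℂ) * (z - 1) = -α + α * z by ring, Complex.exp_add]
    ring

lemma exp_factor {γ : ℕ → ℝ} (hs : Summable γ) (α : ℝ) (w : ℂ) :
    Complex.exp (α * w) * ∏' j, (1 + (γ j : ℂ) * w) =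
    Complex.exp (((α + ∑' j, γ j : ℝ) : ℂ) * w) *
      ∏' j, (1 + ((1 + (γ j : ℂ) * w) * Complex.exp (-((γ j : ℂ) * w)) - 1)) := by
  have h1 : HasSum (fun j => -((γ j : ℂ) * w)) (-(((∑' j, γ j : ℝ) : ℂ) * w)) :=
    ((Complex.hasSum_ofReal.2 hs.hasSum).mul_right w).neg
  have h2 := (mult_aux hs w).hasProd.mul h1.cexp
  have h3 : ∏' j, (1 + ((1 + (γ j : ℂ) * w) * Complex.exp (-((γ j : ℂ) * w)) - 1)) =
      (∏' j, (1 + (γ j : ℂ) * w)) * Complex.exp (-(((∑' j, γ j : ℝ) : ℂ) * w)) := by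
    rw [← h2.tprod_eq]
    refine tprod_congr fun j => ?_
    simp
  rw [h3, Complex.ofReal_add, add_mul, Complex.exp_add, Complex.exp_neg]
  field_simp

lemma factor_bound (x : ℂ) (R : ℝ) (hx : ‖x‖ ≤ R) :
    ‖(1 + x) * Complex.exp (-x) - 1‖ ≤ (1 + Real.exp R * (1 + R)) * ‖x‖ ^ 2 := by
  have h := Complex.norm_exp_sub_sum_le_norm_mul_exp (-x) 2
  simp only [Finset.sum_range_succ, Finset.sum_range_zero, norm_neg] at h
  simp at h
  set r := Complex.exp (-x) - (1 + -x) with hr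
  have e : (1 + x) * Complex.exp (-x) - 1 = -x ^ 2 + (1 + x) * r := by rw [hr]; ring
  rw [e]
  have hR : 0 ≤ R := (norm_nonneg x).trans hx
  have h1 : ‖1 + x‖ ≤ 1 + R := (norm_add_le _ _).trans (by simpa using hx)
  have h2 : ‖r‖ ≤ ‖x‖ ^ 2 * Real.exp R := h.trans (by gcongr)
  calc _ ≤ ‖x‖ ^ 2 + ‖1 + x‖ * ‖r‖ := (norm_add_le _ _).trans (by simp)
    _ ≤ ‖x‖ ^ 2 + (1 + R) * (‖x‖ ^ 2 * Real.exp R) := by gcongr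
    _ = _ := by ring

lemma core (B : ℝ) (α : ℕ → ℝ) (γ : ℕ → ℕ → ℝ) (hα : ∀ n, 0 ≤ α n) (γ0 : ∀ n j, 0 ≤ γ n j)
    (γ1 : ∀ n j, γ n j ≤ 1) (hm : ∀ n j, γ n (j + 1) ≤ γ n j) (hs : ∀ n, Summable (γ n))
    (hB : ∀ n, α n + ∑' j, γ n j ≤ B) :
    ∃ (φ : ℕ → ℕ) (α' : ℝ) (γ' : ℕ → ℝ), StrictMono φ ∧ 0 ≤ α' ∧ (∀ j, 0 ≤ γ' j) ∧
      (∀ j, γ' j ≤ 1) ∧ (∀ j, γ' (j + 1) ≤ γ' j) ∧ Summable γ' ∧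
      ∀ w : ℂ, Tendsto (fun n => Complex.exp (α (φ n) * w) * ∏' j, (1 + (γ (φ n) j : ℂ) * w)) atTop
        (𝓝 (Complex.exp (α' * w) * ∏' j, (1 + (γ' j : ℂ) * w))) := by
  set m : ℕ → ℝ := fun n => α n + ∑' j, γ n j with hmdef
  have hK : IsCompact (Set.Icc (0:ℝ) B ×ˢ Set.pi Set.univ (fun _ : ℕ => Set.Icc (0:ℝ) 1)) :=
    isCompact_Icc.prod (isCompact_univ_pi fun _ => isCompact_Icc)
  have hmem : ∀ n, (m n, γ n) ∈
      (Set.Icc (0:ℝ) B ×ˢ Set.pi Set.univ (fun _ : ℕ => Set.Icc (0:ℝ) 1)) := fun n =>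
    ⟨⟨add_nonneg (hα n) (tsum_nonneg (γ0 n)), hB n⟩, fun j _ => ⟨γ0 n j, γ1 n j⟩⟩
  obtain ⟨⟨m', γ'⟩, hmem', φ, hφ, hlim⟩ := hK.tendsto_subseq hmem
  have hmlim : Tendsto (fun n => m (φ n)) atTop (𝓝 m') :=
    (continuous_fst.tendsto _).comp hlim
  have hγlim : ∀ j, Tendsto (fun n => γ (φ n) j) atTop (𝓝 (γ' j)) := fun j =>
    (((continuous_apply j).comp continuous_snd).tendsto _).comp hlim
  have γ'0 : ∀ j, 0 ≤ γ' j := fun j => ge_of_tendsto' (hγlim j) fun n => γ0 _ j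
  have hpart : ∀ n k, ∑ j ∈ Finset.range k, γ n j ≤ m n := fun n k => by
    have := (hs n).sum_le_tsum (Finset.range k) (fun j _ => γ0 n j)
    simp only [hmdef]
    linarith [hα n]
  have hsum' : ∀ k, ∑ j ∈ Finset.range k, γ' j ≤ m' := fun k =>
    le_of_tendsto_of_tendsto' (tendsto_finsetSum _ fun j _ => hγlim j) hmlim fun n => hpart _ k
  have γ's : Summable γ' := summable_of_sum_range_le γ'0 hsum'
  have htsum : ∑' j, γ' j ≤ m' := Real.tsum_le_of_sum_range_le γ'0 hsum'
  refine ⟨φ, m' - ∑' j, γ' j, γ', hφ, by linarith, γ'0,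
    fun j => le_of_tendsto' (hγlim j) fun n => γ1 _ j,
    fun j => le_of_tendsto_of_tendsto' (hγlim (j+1)) (hγlim j) fun n => hm _ j, γ's, fun w => ?_⟩
  rw [exp_factor γ's]
  simp_rw [fun n => exp_factor (hs n)]
  rw [sub_add_cancel]
  refine Tendsto.mul ?_ ?_
  · refine (Complex.continuous_exp.tendsto _).comp (Tendsto.mul_const w ?_)
    exact (Complex.continuous_ofReal.tendsto _).comp hmlim
  · have hdec : ∀ n j, γ n j ≤ B / (j + 1) := by
      intro n j
      have hanti : Antitone (γ n) := antitone_nat_of_succ_le (hm n)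
      have h1 : (j + 1 : ℝ) * γ n j ≤ ∑ i ∈ Finset.range (j + 1), γ n i := by
        have := Finset.card_nsmul_le_sum (Finset.range (j + 1)) (γ n) (γ n j)
          (fun i hi => hanti (Nat.lt_succ_iff.1 (Finset.mem_range.1 hi)))
        simpa using this
      rw [le_div_iff₀ (by positivity)]
      linarith [hpart n (j+1), hB n]
    have hsq : Summable (fun j : ℕ => (1 + Real.exp ‖w‖ * (1 + ‖w‖)) *
        ((B ^ 2 * ‖w‖ ^ 2) * (1 / ((j + 1 : ℕ) : ℝ) ^ 2))) := by
      refine Summable.mul_left _ (Summable.mul_left _ ?_)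
      exact (summable_nat_add_iff 1).2 (Real.summable_one_div_nat_pow.2 one_lt_two)
    refine tendsto_tprod_one_add_of_dominated_convergence hsq (fun k => ?_) (.of_forall fun n k => ?_)
    · have hc : Continuous (fun t : ℝ => (1 + (t : ℂ) * w) * Complex.exp (-((t : ℂ) * w)) - 1) := by
        fun_prop
      exact (hc.tendsto _).comp (hγlim k)
    · have hnorm : ‖(γ (φ n) k : ℂ) * w‖ = γ (φ n) k * ‖w‖ := by
        rw [norm_mul, Complex.norm_real, Real.norm_of_nonneg (γ0 _ _)]
      refine (factor_bound _ ‖w‖ ?_).trans ?_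
      · rw [hnorm]
        exact mul_le_of_le_one_left (norm_nonneg w) (γ1 _ _)
      · refine mul_le_mul_of_nonneg_left ?_ (by positivity)
        rw [hnorm, mul_pow]
        have := pow_le_pow_left₀ (γ0 (φ n) k) (hdec (φ n) k) 2
        calc _ ≤ (B / (k + 1)) ^ 2 * ‖w‖ ^ 2 := by gcongr
          _ = _ := by push_cast; field_simp

lemma prod_ge {γ : ℕ → ℝ} (γ0 : ∀ j, 0 ≤ γ j) (hs : Summable γ) :
    1 + ∑' j, γ j ≤ ‖∏' j, (1 + (γ j : ℂ) * 1)‖ := by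
  have h1 := (mult_aux hs 1).hasProd.tendsto_prod_nat.norm
  have h2 := hs.hasSum.tendsto_sum_nat.const_add 1
  refine le_of_tendsto_of_tendsto' h2 h1 fun n => ?_
  have e : ∏ j ∈ Finset.range n, (1 + (γ j : ℂ) * 1) = ((∏ j ∈ Finset.range n, (1 + γ j) : ℝ) : ℂ) := by
    push_cast; simp
  rw [e, Complex.norm_real]
  refine le_trans ?_ (le_abs_self _)
  induction n with
  | zero => simp
  | succ n ih =>
    rw [Finset.sum_range_succ, Finset.prod_range_succ]
    have : 0 ≤ ∑ j ∈ Finset.range n, γ j := Finset.sum_nonneg fun j _ => γ0 j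
    have := ih (by push_cast; simp)
    nlinarith [γ0 n]

lemma sh_lim {f : ℕ → ℂ → ℂ} {g : ℂ → ℂ} (hf : ∀ n, Sh (f n))
    (hlim : ∀ z, Tendsto (fun n => f n z) atTop (𝓝 (g z))) (hg : g 1 ≠ 0) : Sh g := by
  choose D α γ hα γ0 γ1 hm hs hz using hf
  have hD : ∀ n, D n = f n 1 := fun n => by rw [hz]; simp
  have h2 : ∀ n, ‖f n 1‖ * (α n + ∑' j, γ n j) ≤ ‖f n 2‖ := by
    intro n
    rw [hz n 2, ← hD, mul_assoc, norm_mul]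
    refine mul_le_mul_of_nonneg_left ?_ (norm_nonneg _)
    rw [show (2:ℂ) - 1 = 1 by norm_num, norm_mul, mul_one, Complex.norm_exp, Complex.ofReal_re]
    have hp := prod_ge (γ0 n) (hs n)
    have he := Real.add_one_le_exp (α n)
    have ht : 0 ≤ ∑' j, γ n j := tsum_nonneg (γ0 n)
    calc α n + ∑' j, γ n j ≤ (α n + 1) * (1 + ∑' j, γ n j) := by nlinarith [hα n]
      _ ≤ _ := mul_le_mul he hp (by linarith) (Real.exp_nonneg _)
  have hg' : 0 < ‖g 1‖ := norm_pos_iff.2 hg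
  have hq : Tendsto (fun n => ‖f n 2‖ / ‖f n 1‖) atTop (𝓝 (‖g 2‖ / ‖g 1‖)) :=
    (hlim 2).norm.div (hlim 1).norm hg'.ne'
  obtain ⟨N, hN⟩ := eventually_atTop.1 ((hq.eventually_lt_const (lt_add_one _)).and
    ((hlim 1).norm.eventually_const_lt hg'))
  obtain ⟨φ, α', γ', hφ, a1, a2, a3, a4, a5, a6⟩ := core (‖g 2‖ / ‖g 1‖ + 1) (fun n => α (n + N))
    (fun n => γ (n + N)) (fun n => hα _) (fun n => γ0 _) (fun n => γ1 _) (fun n => hm _)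
    (fun n => hs _) (fun n => by
      obtain ⟨b1, b2⟩ := hN (n + N) (by omega)
      refine le_trans ?_ b1.le
      rw [le_div_iff₀ b2]
      linarith [h2 (n + N)])
  refine ⟨g 1, α', γ', a1, a2, a3, a4, a5, fun z => ?_⟩
  have hsub : Tendsto (fun n => φ n + N) atTop atTop :=
    tendsto_atTop_mono (fun n => Nat.le_add_right _ _) hφ.tendsto_atTop
  have t1 := (hlim z).comp hsub
  have t2 := ((hlim 1).comp hsub).mul (a6 (z - 1))
  rw [mul_assoc]
  refine tendsto_nhds_unique t1 (t2.congr fun n => ?_)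
  simp only [Function.comp]
  rw [hz _ z, hD]
  ring

theorem stmt_7 (a : ℝ) (ha : 0 ≤ a) (f : ℕ → ℂ → ℂ) (g : ℂ → ℂ)
    (hL : ∀ n, LaguerrePlus (f n)) (hA : ∀ n, InA a (f n))
    (hgA : InA a g) (hg0 : ∃ z, g z ≠ 0)
    (hconv : ∀ K : Set ℂ, IsCompact K → TendstoUniformlyOn (fun n => f n) g atTop K) :
    (∀ b > a, (⨆ n, normB b (f n)) < ⊤) ∧
    (∀ b > a, Tendsto (fun n => normB b (f n - g)) atTop (nhds 0)) ∧
    LaguerrePlus g := by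
  have hloc : TendstoLocallyUniformlyOn f g atTop Set.univ := by
    rw [tendstoLocallyUniformlyOn_iff_forall_isCompact isOpen_univ]
    exact fun K _ hK => hconv K hK
  have hc := tendsto_iteratedDeriv (fun n => (hA n).1) hloc
  have hlim : ∀ z, Tendsto (fun n => f n z) atTop (𝓝 (g z)) := fun z =>
    hloc.tendsto_at (Set.mem_univ z)
  obtain ⟨h1, h2⟩ := part12 a ha f g hL hA hgA hg0 hc
  refine ⟨h1, h2, laguerre_of_sh (sh_lim (fun n => sh_of_laguerre (hL n)) hlim ?_)⟩
  obtain ⟨k, hk⟩ := exists_coeff_ne hgA.1 hg0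
  have : ‖iteratedDeriv k g 0‖ / k.factorial ≤ ‖g 1‖ :=
    le_of_tendsto_of_tendsto' ((hc k).norm.div_const _) (hlim 1).norm
      fun n => laguerre_coeff_le (hL n) k
  have hpos : 0 < ‖iteratedDeriv k g 0‖ / k.factorial :=
    div_pos (norm_pos_iff.2 hk) (by positivity)
  exact norm_pos_iff.1 (hpos.trans_le this)
end

section
/- For all κ ≥ 0 and θ ≥ 0: if f ∈ L^+, then the entire function z ↦ κ f(z) + θ f'(z) + z f''(z), i.e. (κ + Δ_θ)f, also belongs to L^+. -/
open Polynomial Filter Topology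

def NegRoots (P : ℂ[X]) : Prop := P ≠ 0 ∧ ∀ z, P.eval z = 0 → z.im = 0 ∧ z.re ≤ 0

lemma multiset_functional (φ : ℂ →+ ℝ) (g : ℂ → ℂ) (M : Multiset ℂ) 
    (h : ∀ r ∈ M, 0 ≤ φ (g r)) : 0 ≤ φ (M.map g).sum := by
  induction M using Multiset.induction_on with
  | empty => simp
  | cons a M ih =>
    simp only [Multiset.map_cons, Multiset.sum_cons, map_add]
    have h1 := h a (by simp)
    have h2 := ih (fun r hr => h r (by simp [hr]))
    linarith

lemma multiset_functional_pos (φ : ℂ →+ ℝ) (g : ℂ → ℂ) (M : Multiset ℂ) (hM : M ≠ 0)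
    (h : ∀ r ∈ M, 0 < φ (g r)) : 0 < φ (M.map g).sum := by
  obtain ⟨a, ha⟩ := Multiset.exists_mem_of_ne_zero hM
  obtain ⟨N, rfl⟩ := Multiset.exists_cons_of_mem ha
  simp only [Multiset.map_cons, Multiset.sum_cons, map_add]
  have h1 := h a (by simp)
  have h2 := multiset_functional φ g N (fun r hr => (h r (by simp [hr])).le)
  linarith

lemma negRoots_derivative {P : ℂ[X]} (hP : NegRoots P) (hd : 0 < P.degree) :
    NegRoots (Polynomial.derivative P) := by
  have h0 : Polynomial.derivative P ≠ 0 := by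
    intro h
    have := Polynomial.derivative_eq_zero.1 h
    rw [← Polynomial.natDegree_pos_iff_degree_pos] at hd
    omega
  refine ⟨h0, fun z hz => ?_⟩
  have h1 : z ∈ P.derivative.rootSet ℂ := by
    rw [mem_rootSet]; exact ⟨h0, by simpa using hz⟩
  have h2 := rootSet_derivative_subset_convexHull_rootSet hd h1
  have hc : Convex ℝ {z : ℂ | z.im = 0 ∧ z.re ≤ 0} := by
    intro x hx y hy a b ha hb hab
    obtain ⟨hx1, hx2⟩ := hx
    obtain ⟨hy1, hy2⟩ := hy
    constructor
    · simp [hx1, hy1]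
    · simp
      nlinarith
  refine convexHull_min ?_ hc h2
  intro w hw
  rw [mem_rootSet] at hw
  exact hP.2 w (by simpa using hw.2)

lemma negRoots_kappa_delta {P : ℂ[X]} (hP : NegRoots P) {κ θ : ℝ} (hκ : 0 < κ) (hθ : 0 ≤ θ) :
    NegRoots (C (κ : ℂ) * P + C (θ : ℂ) * derivative P + X * derivative (derivative P)) := by
  suffices H : ∀ z : ℂ, ¬ (z.im = 0 ∧ z.re ≤ 0) →
      (C (κ : ℂ) * P + C (θ : ℂ) * derivative P + X * derivative (derivative P)).eval z ≠ 0 by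
    constructor
    · intro h
      apply H 1 (by simp)
      rw [h]; simp
    · intro z hz
      by_contra hc
      exact H z hc hz
  intro z hz
  have hPz : P.eval z ≠ 0 := fun h => hz (hP.2 z h)
  by_cases hd : 0 < P.degree
  swap
  · have : P.natDegree = 0 := by
      rw [← Polynomial.natDegree_pos_iff_degree_pos] at hd
      omega
    rw [Polynomial.derivative_of_natDegree_zero this]
    simp [hPz, hκ.ne']
  have hP' := negRoots_derivative hP hd
  have hP'z : (derivative P).eval z ≠ 0 := fun h => hz (hP'.2 z h)
  have hs := (IsAlgClosed.splits P).eval_derivative_div_eval_of_ne_zero hPz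
  have ht := (IsAlgClosed.splits (derivative P)).eval_derivative_div_eval_of_ne_zero hP'z
  have hr0 : P.roots ≠ 0 := by
    intro h
    have h1 := (IsAlgClosed.splits P).natDegree_eq_card_roots
    rw [h] at h1
    rw [← Polynomial.natDegree_pos_iff_degree_pos] at hd
    simp at h1
    omega
  have ht2 : z * (eval z (derivative (derivative P)) / eval z (derivative P)) =
      ((derivative P).roots.map fun y ↦ z / (z - y)).sum := by
    rw [ht, ← Multiset.sum_map_mul_left]
    congr 1
    apply Multiset.map_congr rfl
    intros; ring
  set s := eval z (derivative P) / eval z P with hsdef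
  set t := z * (eval z (derivative (derivative P)) / eval z (derivative P)) with htdef
  have hs0 : s ≠ 0 := div_ne_zero hP'z hPz
  intro hQ
  have hE : (κ : ℂ) * s⁻¹ + θ + t = 0 := by
    simp only [eval_add, eval_mul, eval_C, eval_X] at hQ
    rw [hsdef, htdef]
    field_simp
    linear_combination hQ
  have hroot : ∀ r ∈ P.roots, r.im = 0 ∧ r.re ≤ 0 := fun r hr =>
    hP.2 r ((Polynomial.mem_roots'.1 hr).2)
  have hroot' : ∀ r ∈ (derivative P).roots, r.im = 0 ∧ r.re ≤ 0 := fun r hr =>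
    hP'.2 r ((Polynomial.mem_roots'.1 hr).2)
  have hns : ∀ r : ℂ, r.im = 0 ∧ r.re ≤ 0 → 0 < Complex.normSq (z - r) := by
    intro r hr
    rw [Complex.normSq_pos]
    intro h
    apply hz
    rw [sub_eq_zero] at h
    rw [h]; exact hr
  have hnss : 0 < Complex.normSq s := Complex.normSq_pos.2 hs0
  by_cases him : z.im = 0
  · have hre : 0 < z.re := by
      by_contra h
      exact hz ⟨him, not_lt.1 h⟩
    have h1 : 0 < s.re := by
      rw [hs]
      refine multiset_functional_pos Complex.reAddGroupHom _ _ hr0 ?_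
      intro r hr
      have h := hns r (hroot r hr)
      obtain ⟨hr1, hr2⟩ := hroot r hr
      simp only [one_div, Complex.reAddGroupHom, AddMonoidHom.coe_mk, ZeroHom.coe_mk, Complex.inv_re]
      apply div_pos _ h
      simp; linarith
    have h2 : 0 ≤ t.re := by
      rw [ht2]
      refine multiset_functional Complex.reAddGroupHom _ _ ?_
      intro r hr
      have h := hns r (hroot' r hr)
      obtain ⟨hr1, hr2⟩ := hroot' r hr
      simp only [Complex.reAddGroupHom, AddMonoidHom.coe_mk, ZeroHom.coe_mk, Complex.div_re]
      simp only [him, hr1, zero_mul, zero_div, add_zero, Complex.sub_re]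
      apply div_nonneg _ h.le
      apply mul_nonneg hre.le; linarith
    have h3 := congrArg Complex.re hE
    simp at h3
    have h4 : 0 < κ * (s.re / Complex.normSq s) := by positivity
    linarith
  · let φ : ℂ →+ ℝ := (AddMonoidHom.mulLeft z.im).comp Complex.imAddGroupHom
    have hφ : ∀ w, φ w = z.im * w.im := fun w => rfl
    have hz2 : 0 < z.im ^ 2 := by positivity
    have h1 : 0 < (-φ) s := by
      rw [hs]
      refine multiset_functional_pos (-φ) _ _ hr0 ?_
      intro r hr
      have h := hns r (hroot r hr)
      obtain ⟨hr1, hr2⟩ := hroot r hr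
      rw [AddMonoidHom.neg_apply, hφ, one_div, Complex.inv_im, Complex.sub_im, hr1]
      have : -(z.im * (-(z.im - 0) / Complex.normSq (z - r))) = z.im^2 / Complex.normSq (z - r) := by
        ring
      rw [this]; positivity
    have h2 : 0 ≤ φ t := by
      rw [ht2]
      refine multiset_functional φ _ _ ?_
      intro r hr
      have h := hns r (hroot' r hr)
      obtain ⟨hr1, hr2⟩ := hroot' r hr
      rw [hφ, Complex.div_im, Complex.sub_im, Complex.sub_re, hr1]
      have : z.im * (z.im * (z.re - r.re) / Complex.normSq (z - r) - z.re * (z.im - 0) / Complex.normSq (z - r)) = z.im^2 * (-r.re) / Complex.normSq (z - r) := by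
        ring
      rw [this]
      apply div_nonneg _ h.le
      apply mul_nonneg hz2.le; linarith
    have h3 := congrArg φ hE
    rw [map_add, map_add, hφ, hφ (θ : ℂ)] at h3
    rw [AddMonoidHom.neg_apply, hφ s] at h1
    simp at h3
    have h4 : 0 < κ * (-(z.im * s.im) / Complex.normSq s) := by positivity
    have h5 : κ * (-(z.im * s.im) / Complex.normSq s) = z.im * (κ * (-s.im / Complex.normSq s)) := by ring
    linarith

lemma negRoots_mul {P Q : ℂ[X]} (hP : NegRoots P) (hQ : NegRoots Q) : NegRoots (P * Q) := by
  refine ⟨mul_ne_zero hP.1 hQ.1, fun z hz => ?_⟩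
  rw [eval_mul, mul_eq_zero] at hz
  exact hz.elim (hP.2 z) (hQ.2 z)

lemma negRoots_C {c : ℂ} (hc : c ≠ 0) : NegRoots (C c) :=
  ⟨C_ne_zero.2 hc, fun z hz => absurd (by simpa using hz) hc⟩

lemma negRoots_one : NegRoots (1 : ℂ[X]) := negRoots_C one_ne_zero

lemma negRoots_pow {P : ℂ[X]} (hP : NegRoots P) (n : ℕ) : NegRoots (P ^ n) := by
  induction n with
  | zero => simpa using negRoots_one
  | succ n ih => rw [pow_succ]; exact negRoots_mul ih hP

lemma negRoots_X : NegRoots (X : ℂ[X]) :=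
  ⟨X_ne_zero, fun z hz => by simp at hz; simp [hz]⟩

lemma negRoots_linear {a : ℝ} (ha : 0 ≤ a) : NegRoots (1 + C (a : ℂ) * X : ℂ[X]) := by
  constructor
  · intro h
    have := congrArg (eval 0) h
    simp at this
  · intro z hz
    simp at hz
    have h1 := congrArg Complex.re hz
    have h2 := congrArg Complex.im hz
    simp at h1 h2
    rcases h2 with h2 | h2
    · simp [h2] at h1
    · refine ⟨h2, ?_⟩
      by_contra h
      push Not at h
      have := mul_nonneg ha h.le
      linarith

lemma negRoots_prod (β : ℕ → ℝ) (hβ : ∀ j, 0 ≤ β j) (n : ℕ) :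
    NegRoots (∏ j ∈ Finset.range n, (1 + C (β j : ℂ) * X) : ℂ[X]) := by
  induction n with
  | zero => simpa using negRoots_one
  | succ n ih => rw [Finset.prod_range_succ]; exact negRoots_mul ih (negRoots_linear (hβ n))

lemma tendsto_prod_locally (β : ℕ → ℝ) (hβ : ∀ j, 0 ≤ β j) (hs : Summable β) :
    TendstoLocallyUniformly (fun (n : ℕ) (z : ℂ) => ∏ j ∈ Finset.range n, (1 + (β j : ℂ) * z))
      (fun z => ∏' j : ℕ, (1 + (β j : ℂ) * z)) atTop := by
  rw [tendstoLocallyUniformly_iff_forall_isCompact]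
  intro K hK
  obtain ⟨R, hR⟩ := hK.isBounded.exists_norm_le
  have h := Summable.hasProdUniformlyOn_nat_one_add (f := fun j (z : ℂ) => (β j : ℂ) * z) hK
    (hs.mul_right R) (Eventually.of_forall fun n x hx => by
      rw [norm_mul, Complex.norm_real, Real.norm_of_nonneg (hβ n)]
      exact mul_le_mul_of_nonneg_left (hR x hx) (hβ n)) (fun n => by fun_prop)
  rw [hasProdUniformlyOn_iff_tendstoUniformlyOn] at h
  exact fun u hu => tendsto_finset_range.eventually (h u hu)

lemma exp_pow_bound (u : ℂ) (n : ℕ) (h : ‖u‖ ≤ n + 1) :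
    ‖(1 + u / (n + 1)) ^ (n + 1) - Complex.exp u‖ ≤ ‖u‖ ^ 2 * Real.exp ‖u‖ / (n + 1) := by
  have hn : (0 : ℝ) < n + 1 := by positivity
  have hnc : ((n : ℂ) + 1) ≠ 0 := by exact_mod_cast hn.ne'
  set v := u / ((n : ℂ) + 1) with hv
  have hvn : ‖v‖ = ‖u‖ / (n + 1) := by
    rw [hv, norm_div]
    congr 1
    have : ((n : ℂ) + 1) = ((n + 1 : ℝ) : ℂ) := by push_cast; rfl
    rw [this, Complex.norm_real, Real.norm_of_nonneg hn.le]
  have hv1 : ‖v‖ ≤ 1 := by rw [hvn]; exact (div_le_one hn).2 h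
  have hexp : Complex.exp u = Complex.exp v ^ (n + 1) := by
    rw [← Complex.exp_nat_mul]; congr 1; rw [hv]; push_cast; field_simp
  have key : ∀ k : ℕ, ‖(1 + v) ^ k - Complex.exp v ^ k‖ ≤ k * ‖v‖ ^ 2 * Real.exp ‖v‖ ^ k := by
    intro k
    have ha : ‖1 + v‖ ≤ Real.exp ‖v‖ := by
      refine (norm_add_le _ _).trans ?_
      rw [norm_one, add_comm]; exact Real.add_one_le_exp _
    have hb : ‖Complex.exp v‖ ≤ Real.exp ‖v‖ := Complex.norm_exp_le_exp_norm v
    have hab : ‖1 + v - Complex.exp v‖ ≤ ‖v‖ ^ 2 := by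
      rw [← norm_neg]
      rw [show -(1 + v - Complex.exp v) = Complex.exp v - 1 - v by ring]
      exact Complex.norm_exp_sub_one_sub_id_le hv1
    have he : 1 ≤ Real.exp ‖v‖ := Real.one_le_exp (norm_nonneg _)
    induction k with
    | zero => simp
    | succ k ih =>
      have : (1 + v) ^ (k + 1) - Complex.exp v ^ (k + 1) =
        ((1 + v) ^ k - Complex.exp v ^ k) * (1 + v) +
          Complex.exp v ^ k * (1 + v - Complex.exp v) := by ring
      rw [this]
      refine (norm_add_le _ _).trans ?_
      rw [norm_mul, norm_mul, norm_pow]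
      have h1 : ‖(1 + v) ^ k - Complex.exp v ^ k‖ * ‖1 + v‖ ≤
          (k * ‖v‖ ^ 2 * Real.exp ‖v‖ ^ k) * Real.exp ‖v‖ := by gcongr
      have h2 : ‖Complex.exp v‖ ^ k * ‖1 + v - Complex.exp v‖ ≤
          Real.exp ‖v‖ ^ k * ‖v‖ ^ 2 := by gcongr
      have h3 : Real.exp ‖v‖ ^ k * ‖v‖ ^ 2 ≤ Real.exp ‖v‖ ^ k * ‖v‖ ^ 2 * Real.exp ‖v‖ :=
        le_mul_of_one_le_right (by positivity) he
      push_cast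
      rw [pow_succ (Real.exp ‖v‖) k]
      linarith
  rw [hexp]
  refine (key (n + 1)).trans (le_of_eq ?_)
  have : Real.exp ‖v‖ ^ (n + 1) = Real.exp ‖u‖ := by
    rw [← Real.exp_nat_mul]; congr 1; rw [hvn]; push_cast; field_simp
  rw [this, hvn]
  push_cast
  field_simp

lemma tendsto_exp_locally (α : ℝ) :
    TendstoLocallyUniformly (fun (n : ℕ) (z : ℂ) => (1 + ((α / (n + 1) : ℝ) : ℂ) * z) ^ (n + 1))
      (fun z => Complex.exp ((α : ℂ) * z)) atTop := by
  rw [tendstoLocallyUniformly_iff_forall_isCompact]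
  intro K hK
  obtain ⟨R, hR⟩ := hK.isBounded.exists_norm_le
  rw [Metric.tendstoUniformlyOn_iff]
  intro ε hε
  have hlim : Tendsto (fun n : ℕ => ((|α| * R) ^ 2 * Real.exp (|α| * R)) * (1 / ((n : ℝ) + 1)))
      atTop (𝓝 (((|α| * R) ^ 2 * Real.exp (|α| * R)) * 0)) :=
    tendsto_one_div_add_atTop_nhds_zero_nat.const_mul _
  rw [mul_zero] at hlim
  have h1 := hlim.eventually (gt_mem_nhds hε)
  obtain ⟨N, hN⟩ := exists_nat_ge (|α| * R)
  filter_upwards [h1, eventually_ge_atTop N] with n hn hnN z hz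
  have hu : ‖(α : ℂ) * z‖ ≤ |α| * R := by
    rw [norm_mul, Complex.norm_real, Real.norm_eq_abs]
    exact mul_le_mul_of_nonneg_left (hR z hz) (abs_nonneg _)
  have hnN' : (N : ℝ) ≤ n := by exact_mod_cast hnN
  have hb := exp_pow_bound ((α : ℂ) * z) n (by linarith)
  rw [dist_comm, dist_eq_norm]
  have he : 1 + ((α / (n + 1) : ℝ) : ℂ) * z = 1 + (α : ℂ) * z / ((n : ℂ) + 1) := by
    push_cast; ring
  rw [he]
  refine lt_of_le_of_lt (hb.trans ?_) hn
  rw [mul_one_div]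
  gcongr

lemma exists_approx (c : ℂ) (hc : c ≠ 0) (l : ℕ) (α : ℝ) (hα : 0 ≤ α) (β : ℕ → ℝ)
    (hβ : ∀ j, 0 ≤ β j) (hs : Summable β) :
    ∃ P : ℕ → ℂ[X], (∀ n, NegRoots (P n)) ∧
      TendstoLocallyUniformly (fun n z => (P n).eval z)
        (fun z => c * z ^ l * Complex.exp ((α : ℂ) * z) * ∏' j : ℕ, (1 + (β j : ℂ) * z)) atTop := by
  refine ⟨fun n => C c * X ^ l * (1 + C ((α / (n + 1) : ℝ) : ℂ) * X) ^ (n + 1) *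
    ∏ j ∈ Finset.range n, (1 + C (β j : ℂ) * X), fun n => ?_, ?_⟩
  · refine negRoots_mul (negRoots_mul (negRoots_mul (negRoots_C hc) (negRoots_pow negRoots_X l))
      (negRoots_pow (negRoots_linear (by positivity)) _)) (negRoots_prod β hβ n)
  · have h1 := tendsto_prod_locally β hβ hs
    have h2 := tendsto_exp_locally α
    have h0 : TendstoLocallyUniformly (fun (n : ℕ) (z : ℂ) => c * z ^ l) (fun z => c * z ^ l)
        atTop := by
      intro u hu x
      exact ⟨Set.univ, univ_mem, Eventually.of_forall fun n y _ => refl_mem_uniformity hu⟩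
    have hc1 : Continuous (fun z : ℂ => ∏' j : ℕ, (1 + (β j : ℂ) * z)) :=
      h1.continuous (Eventually.of_forall fun n => by fun_prop).frequently
    have h3 := (h0.mul₀ h2 (by fun_prop) (by fun_prop)).mul₀ h1
      (by
        have : Continuous fun z : ℂ => c * z ^ l * Complex.exp ((α : ℂ) * z) := by fun_prop
        exact this) hc1
    refine h3.congr (fun n z => ?_)
    simp [eval_prod]

lemma exists_sorted_seq (M : Multiset ℝ) (hM : ∀ x ∈ M, 0 ≤ x ∧ x ≤ 1) :
    ∃ (γ : ℕ → ℝ) (N : ℕ), Antitone γ ∧ (∀ j, 0 ≤ γ j ∧ γ j ≤ 1) ∧ (∀ j, N ≤ j → γ j = 0) ∧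
      (∀ F : ℝ → ℂ, (M.map F).prod = ∏ j ∈ Finset.range N, F (γ j)) ∧
      (∀ F : ℝ → ℂ, (M.map F).sum = ∑ j ∈ Finset.range N, F (γ j)) := by
  set L := M.sort (· ≥ ·) with hL
  have hLM : (L : Multiset ℝ) = M := Multiset.sort_eq M _
  have hmem : ∀ x ∈ L, 0 ≤ x ∧ x ≤ 1 := fun x hx => hM x (by rw [← hLM]; simpa using hx)
  have hsort : L.Pairwise (· ≥ ·) := Multiset.pairwise_sort M _
  have hget : ∀ j (h : j < L.length), L.getD j 0 = L[j] := fun j h => by simp [h]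
  have hzero : ∀ j, L.length ≤ j → L.getD j 0 = 0 := fun j h => by simp [h]
  have hb : ∀ j, 0 ≤ L.getD j 0 ∧ L.getD j 0 ≤ 1 := by
    intro j
    by_cases h : j < L.length
    · rw [hget j h]; exact hmem _ (List.getElem_mem h)
    · rw [hzero j (not_lt.1 h)]; simp
  refine ⟨fun j => L.getD j 0, L.length, ?_, hb, hzero, ?_, ?_⟩
  · intro i j hij
    by_cases h : j < L.length
    · change L.getD j 0 ≤ L.getD i 0
      rcases hij.eq_or_lt with rfl | hlt
      · exact le_rfl
      rw [hget j h, hget i (hlt.trans h)]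
      exact (List.pairwise_iff_getElem.1 hsort) i j _ _ hlt
    · change L.getD j 0 ≤ L.getD i 0
      rw [hzero j (not_lt.1 h)]; exact (hb i).1
  · intro F
    rw [← hLM, Multiset.map_coe, Multiset.prod_coe, Finset.prod_range, ← List.prod_ofFn]
    congr 1
    apply List.ext_getElem
    · simp
    · intro i h1 h2; simp
  · intro F
    rw [← hLM, Multiset.map_coe, Multiset.sum_coe, Finset.sum_range, ← List.sum_ofFn]
    congr 1
    apply List.ext_getElem
    · simp
    · intro i h1 h2; simp

lemma negRoots_one_ne {P : ℂ[X]} (hP : NegRoots P) : P.eval 1 ≠ 0 := by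
  intro h
  have := (hP.2 1 h).2
  simp at this
  linarith

lemma exists_gamma {P : ℂ[X]} (hP : NegRoots P) :
    ∃ (γ : ℕ → ℝ) (N : ℕ), Antitone γ ∧ (∀ j, 0 ≤ γ j ∧ γ j ≤ 1) ∧ (∀ j, N ≤ j → γ j = 0) ∧
      (∀ w : ℂ, P.eval (1 + w) = P.eval 1 * ∏ j ∈ Finset.range N, (1 + (γ j : ℂ) * w)) ∧
      (derivative P).eval 1 / P.eval 1 = ((∑ j ∈ Finset.range N, γ j : ℝ) : ℂ) := by
  have hroot : ∀ r ∈ P.roots, r.im = 0 ∧ r.re ≤ 0 := fun r hr =>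
    hP.2 r ((Polynomial.mem_roots'.1 hr).2)
  have hP1 := negRoots_one_ne hP
  obtain ⟨γ, N, hanti, hb, hz, hprod, hsum⟩ :=
    exists_sorted_seq (P.roots.map fun r => (1 - r.re)⁻¹) (by
      intro x hx
      rw [Multiset.mem_map] at hx
      obtain ⟨r, hr, rfl⟩ := hx
      have := (hroot r hr).2
      exact ⟨inv_nonneg.2 (by linarith), inv_le_one_of_one_le₀ (by linarith)⟩)
  have hr1 : ∀ r ∈ P.roots, ((1 - r.re : ℝ) : ℂ) = 1 - r ∧ (1 - r) ≠ 0 := by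
    intro r hr
    obtain ⟨h1, h2⟩ := hroot r hr
    have : ((1 - r.re : ℝ) : ℂ) = 1 - r := by
      apply Complex.ext <;> simp [h1]
    refine ⟨this, ?_⟩
    rw [← this, Complex.ofReal_ne_zero]
    linarith
  refine ⟨γ, N, hanti, hb, hz, ?_, ?_⟩
  · intro w
    rw [← hprod (fun x => 1 + (x : ℂ) * w), (IsAlgClosed.splits P).eval_eq_prod_roots,
      (IsAlgClosed.splits P).eval_eq_prod_roots, mul_assoc, Multiset.map_map,
      ← Multiset.prod_map_mul]
    congr 2
    apply Multiset.map_congr rfl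
    intro r hr
    obtain ⟨h1, h2⟩ := hr1 r hr
    simp only [Function.comp]
    rw [Complex.ofReal_inv, h1]
    field_simp
    ring
  · rw [(IsAlgClosed.splits P).eval_derivative_div_eval_of_ne_zero hP1, Complex.ofReal_sum,
      ← hsum (fun x => (x : ℂ)), Multiset.map_map]
    congr 1
    apply Multiset.map_congr rfl
    intro r hr
    obtain ⟨h1, h2⟩ := hr1 r hr
    simp only [Function.comp]
    rw [Complex.ofReal_inv, h1, one_div]

lemma negRoots_norm_le {P : ℂ[X]} (hP : NegRoots P) (z : ℂ) (hz : ‖z‖ ≤ 1) :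
    ‖P.eval z‖ ≤ ‖P.eval 1‖ := by
  obtain ⟨γ, N, hanti, hb, hz0, hprod, hsum⟩ := exists_gamma hP
  have h := hprod (z - 1)
  rw [add_sub_cancel] at h
  rw [h, norm_mul]
  refine mul_le_of_le_one_right (norm_nonneg _) ?_
  rw [norm_prod]
  refine Finset.prod_le_one (fun _ _ => norm_nonneg _) (fun j _ => ?_)
  have : 1 + (γ j : ℂ) * (z - 1) = ((1 - γ j : ℝ) : ℂ) + (γ j : ℂ) * z := by push_cast; ring
  rw [this]
  refine (norm_add_le _ _).trans ?_
  rw [norm_mul, Complex.norm_real, Complex.norm_real, Real.norm_of_nonneg (by linarith [(hb j).2]),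
    Real.norm_of_nonneg (hb j).1]
  nlinarith [(hb j).1, (hb j).2]

/-- Conversion from the expansion at `1` to the expansion at `0`. -/
lemma laguerrePlus_of_shift (c : ℂ) (α : ℝ) (hα : 0 ≤ α) (γ : ℕ → ℝ) (hanti : Antitone γ)
    (hb : ∀ j, 0 ≤ γ j ∧ γ j ≤ 1) (hs : Summable γ) (g : ℂ → ℂ)
    (hg : ∀ w : ℂ, g (1 + w) = c * Complex.exp (α * w) * ∏' j : ℕ, (1 + (γ j : ℂ) * w)) :
    LaguerrePlus g := by
  have hex : ∃ l, γ l < 1 := by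
    have := hs.tendsto_atTop_zero.eventually (gt_mem_nhds (zero_lt_one (α := ℝ)))
    exact this.exists
  classical
  set l := Nat.find hex with hl
  have hl1 : γ l < 1 := Nat.find_spec hex
  have hlt : ∀ j < l, γ j = 1 := fun j hj =>
    le_antisymm (hb j).2 (not_lt.1 (Nat.find_min hex hj))
  have hge : ∀ j, γ (j + l) ≤ γ l := fun j => hanti (by omega)
  have hpos : ∀ j, 0 < 1 - γ (j + l) := fun j => by linarith [hge j]
  have hs' : Summable fun j => γ (j + l) := (summable_nat_add_iff l).2 hs
  have hβs : Summable fun j => γ (j + l) / (1 - γ (j + l)) := by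
    refine Summable.of_nonneg_of_le (fun j => div_nonneg (hb _).1 (hpos j).le) (fun j => ?_)
      (hs'.mul_right (1 - γ l)⁻¹)
    rw [div_eq_mul_inv]
    refine mul_le_mul_of_nonneg_left ?_ (hb _).1
    exact inv_anti₀ (by linarith) (by linarith [hge j])
  refine ⟨c * Complex.exp (-α) * ∏' j, (1 - (γ (j + l) : ℂ)), l, α,
    fun j => γ (j + l) / (1 - γ (j + l)), hα, fun j => div_nonneg (hb _).1 (hpos j).le, ?_, hβs, ?_⟩
  · intro j
    have h : γ (j + 1 + l) ≤ γ (j + l) := hanti (by omega)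
    have := (hb (j + l)).1
    exact div_le_div₀ this h (hpos j) (by linarith)
  · intro z
    have hz := hg (z - 1)
    rw [add_sub_cancel] at hz
    rw [hz]
    have hm : ∀ (δ : ℕ → ℝ) (_ : ∀ j, 0 ≤ δ j) (_ : Summable δ) (w : ℂ),
        Multipliable fun j => (1 + (δ j : ℂ) * w) := by
      intro δ h0 h1 w
      apply multipliable_one_add_of_summable
      refine (h1.mul_right ‖w‖).congr (fun j => ?_)
      rw [norm_mul, Complex.norm_real, Real.norm_of_nonneg (h0 j)]
    have hm1 := hm (fun j => γ (j + l)) (fun j => (hb _).1) hs' (z - 1)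
    have hm2 := hm _ (fun j => div_nonneg (hb (j+l)).1 (hpos j).le) hβs z
    have hm3 : Multipliable fun j => (1 - (γ (j + l) : ℂ)) := by
      refine (hm (fun j => γ (j + l)) (fun j => (hb _).1) hs' (-1)).congr (fun j => ?_)
      ring
    rw [← Multipliable.prod_mul_tprod_nat_mul' (f := fun j => 1 + (γ j : ℂ) * (z - 1)) (k := l) hm1]
    have h1 : ∏ j ∈ Finset.range l, (1 + (γ j : ℂ) * (z - 1)) = z ^ l := by
      rw [Finset.prod_congr rfl (g := fun _ => z)]
      · simp
      · intro j hj
        rw [hlt j (Finset.mem_range.1 hj)]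
        push_cast; ring
    have h2 : ∏' j, (1 + (γ (j + l) : ℂ) * (z - 1)) =
        (∏' j, (1 - (γ (j + l) : ℂ))) *
          ∏' j, (1 + ((γ (j + l) / (1 - γ (j + l)) : ℝ) : ℂ) * z) := by
      rw [← hm3.tprod_mul hm2]
      refine tprod_congr fun j => ?_
      have : (1 - (γ (j + l) : ℂ)) ≠ 0 := by exact_mod_cast (hpos j).ne'
      push_cast
      field_simp
      ring
    rw [h1, h2, show (α : ℂ) * (z - 1) = -α + α * z by ring, Complex.exp_add]
    ring

lemma norm_weierstrass_le (w : ℂ) : ‖(1 + w) * Complex.exp (-w) - 1‖ ≤ ‖w‖ ^ 2 * (4 * Real.exp ‖w‖) := by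
  by_cases h : ‖w‖ ≤ 1
  · have h1 : ‖Complex.exp (-w) - 1 - (-w)‖ ≤ ‖w‖ ^ 2 := by
      simpa using Complex.norm_exp_sub_one_sub_id_le (x := -w) (by simpa using h)
    have h2 : (1 + w) * Complex.exp (-w) - 1 = (1 + w) * (Complex.exp (-w) - 1 - (-w)) - w ^ 2 := by
      ring
    rw [h2]
    refine (norm_sub_le _ _).trans ?_
    rw [norm_mul, norm_pow]
    have h3 : ‖1 + w‖ ≤ 2 := (norm_add_le _ _).trans (by rw [norm_one]; linarith)
    have h4 : 1 ≤ Real.exp ‖w‖ := Real.one_le_exp (norm_nonneg _)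
    have h5 : ‖1 + w‖ * ‖Complex.exp (-w) - 1 - (-w)‖ ≤ 2 * ‖w‖ ^ 2 := by gcongr
    nlinarith [sq_nonneg ‖w‖]
  · push Not at h
    refine (norm_sub_le _ _).trans ?_
    rw [norm_mul, norm_one]
    have h1 : ‖1 + w‖ ≤ 2 * ‖w‖ := (norm_add_le _ _).trans (by rw [norm_one]; linarith)
    have h2 : ‖Complex.exp (-w)‖ ≤ Real.exp ‖w‖ := by
      simpa using Complex.norm_exp_le_exp_norm (-w)
    have h3 : ‖1 + w‖ * ‖Complex.exp (-w)‖ ≤ 2 * ‖w‖ * Real.exp ‖w‖ := by gcongr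
    have h4 : 1 ≤ Real.exp ‖w‖ := Real.one_le_exp (norm_nonneg _)
    have h5 : ‖w‖ * Real.exp ‖w‖ ≤ ‖w‖ ^ 2 * Real.exp ‖w‖ := by
      gcongr; nlinarith
    have h6 : 1 ≤ ‖w‖ * Real.exp ‖w‖ := by nlinarith
    nlinarith

lemma laguerrePlus_of_limit (P : ℕ → ℂ[X]) (hP : ∀ n, NegRoots (P n)) (g : ℂ → ℂ)
    (hlim : TendstoLocallyUniformly (fun n z => (P n).eval z) g atTop) : LaguerrePlus g := by
  have hpt : ∀ z, Tendsto (fun n => (P n).eval z) atTop (𝓝 (g z)) := fun z =>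
    (tendstoLocallyUniformlyOn_univ.2 hlim).tendsto_at (Set.mem_univ z)
  have hdiff : ∀ n, DifferentiableOn ℂ (fun z => (P n).eval z) Set.univ := fun n =>
    (P n).differentiable.differentiableOn
  have hgd : Differentiable ℂ g := by
    rw [← differentiableOn_univ]
    exact (tendstoLocallyUniformlyOn_univ.2 hlim).differentiableOn
      (Eventually.of_forall hdiff) isOpen_univ
  have hder : Tendsto (fun n => (derivative (P n)).eval 1) atTop (𝓝 (deriv g 1)) := by
    have := ((tendstoLocallyUniformlyOn_univ.2 hlim).deriv
      (Eventually.of_forall hdiff) isOpen_univ).tendsto_at (Set.mem_univ 1)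
    refine this.congr (fun n => ?_)
    simp [Polynomial.deriv]
  by_cases hg1 : g 1 = 0
  · -- then g vanishes identically
    have hball : ∀ z ∈ Metric.ball (0 : ℂ) 1, g z = 0 := by
      intro z hz
      have hz1 : ‖z‖ ≤ 1 := by simpa using (mem_ball_zero_iff.1 hz).le
      have h1 := le_of_tendsto_of_tendsto' (hpt z).norm (hpt 1).norm
        (fun n => negRoots_norm_le (hP n) z hz1)
      rw [hg1, norm_zero] at h1
      exact norm_le_zero_iff.1 h1
    have hg0 : g = 0 := by
      have ha : AnalyticOnNhd ℂ g Set.univ := fun z _ => hgd.analyticAt z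
      have hb : AnalyticOnNhd ℂ (0 : ℂ → ℂ) Set.univ := fun z _ => analyticAt_const
      refine ha.eq_of_eventuallyEq hb (z₀ := 0) ?_
      filter_upwards [Metric.ball_mem_nhds (0 : ℂ) one_pos] with z hz using hball z hz
    refine ⟨0, 0, 0, 0, le_rfl, fun _ => le_rfl, fun _ => le_rfl, summable_zero, fun z => ?_⟩
    simp [hg0]
  choose γ N hanti hb hz hprod hsum using fun n => exists_gamma (hP n)
  set S : ℕ → ℝ := fun n => ∑ j ∈ Finset.range (N n), γ n j with hS
  have hSlim : Tendsto S atTop (𝓝 (deriv g 1 / g 1).re) := by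
    have h := (hder.div (hpt 1) hg1)
    have h2 := (Complex.continuous_re.tendsto _).comp h
    refine h2.congr (fun n => ?_)
    simp only [Function.comp, Pi.div_apply]
    rw [hsum n, Complex.ofReal_re]
  set T := (deriv g 1 / g 1).re with hT
  obtain ⟨M, hM⟩ := hSlim.bddAbove_range
  have hSM : ∀ n, S n ≤ M := fun n => hM ⟨n, rfl⟩
  have hsub : ∀ n k, ∑ j ∈ Finset.range k, γ n j ≤ S n := by
    intro n k
    have h1 : ∑ j ∈ Finset.range k, γ n j ≤ ∑ j ∈ Finset.range (max k (N n)), γ n j :=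
      Finset.sum_le_sum_of_subset_of_nonneg (Finset.range_mono (le_max_left _ _))
        (fun j _ _ => (hb n j).1)
    have h2 : ∑ j ∈ Finset.range (max k (N n)), γ n j = S n := by
      symm
      refine Finset.sum_subset (Finset.range_mono (le_max_right _ _)) (fun j _ hj => ?_)
      exact hz n j (by simpa using hj)
    linarith
  have hM0 : 0 ≤ M := (by simpa using hsub 0 0 : 0 ≤ S 0).trans (hSM 0)
  have hγM : ∀ n j, γ n j ≤ M / (j + 1) := by
    intro n j
    rw [le_div_iff₀ (by positivity)]
    have h1 : ∑ i ∈ Finset.range (j + 1), γ n j ≤ ∑ i ∈ Finset.range (j + 1), γ n i :=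
      Finset.sum_le_sum (fun i hi => hanti n (by have := Finset.mem_range.1 hi; omega))
    simp at h1
    linarith [hsub n (j + 1), hSM n]
  -- extract a convergent subsequence
  obtain ⟨δ, hδmem, φ, hφ, hδ⟩ := (isCompact_univ_pi (fun _ : ℕ => isCompact_Icc (a := (0:ℝ)) (b := 1))).tendsto_subseq
    (x := γ) (fun n j _ => hb n j)
  rw [tendsto_pi_nhds] at hδ
  have hδb : ∀ j, 0 ≤ δ j ∧ δ j ≤ 1 := fun j => hδmem j (Set.mem_univ j)
  have hδanti : Antitone δ := fun i j hij =>
    le_of_tendsto_of_tendsto' (hδ j) (hδ i) (fun n => hanti (φ n) hij)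
  have hSφ : Tendsto (fun n => S (φ n)) atTop (𝓝 T) := hSlim.comp hφ.tendsto_atTop
  have hδpart : ∀ k, ∑ j ∈ Finset.range k, δ j ≤ T := fun k =>
    le_of_tendsto_of_tendsto' (tendsto_finsetSum _ (fun j _ => hδ j)) hSφ
      (fun n => hsub (φ n) k)
  have hδs : Summable δ := summable_of_sum_range_le (fun j => (hδb j).1) hδpart
  have hδT : ∑' j, δ j ≤ T := hδs.tsum_le_of_sum_range_le hδpart
  refine laguerrePlus_of_shift (g 1) (T - ∑' j, δ j) (by linarith) δ hδanti hδb hδs g ?_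
  intro w
  -- Weierstrass form
  have hfin : ∀ n, (P n).eval (1 + w) = (P n).eval 1 * Complex.exp (S n * w) *
      ∏' j, (1 + ((1 + (γ n j : ℂ) * w) * Complex.exp (-((γ n j : ℂ) * w)) - 1)) := by
    intro n
    rw [hprod n w, tprod_eq_prod (s := Finset.range (N n))]
    · rw [mul_assoc]
      congr 1
      have : Complex.exp (S n * w) = ∏ j ∈ Finset.range (N n), Complex.exp ((γ n j : ℂ) * w) := by
        rw [← Complex.exp_sum, hS]
        push_cast
        rw [Finset.sum_mul]
      rw [this, ← Finset.prod_mul_distrib]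
      refine Finset.prod_congr rfl fun j _ => ?_
      have he : Complex.exp ((γ n j : ℂ) * w) * Complex.exp (-((γ n j : ℂ) * w)) = 1 := by
        rw [← Complex.exp_add]; simp
      linear_combination (-(1 + (γ n j : ℂ) * w)) * he
    · intro j hj
      rw [hz n j (by simpa using hj)]
      simp
  have hlimprod : Tendsto (fun n => ∏' j, (1 + ((1 + (γ (φ n) j : ℂ) * w) *
      Complex.exp (-((γ (φ n) j : ℂ) * w)) - 1))) atTop
      (𝓝 (∏' j, (1 + ((1 + (δ j : ℂ) * w) * Complex.exp (-((δ j : ℂ) * w)) - 1)))) := by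
    refine tendsto_tprod_one_add_of_dominated_convergence
      (bound := fun j : ℕ => (1 / ((j : ℝ) + 1) ^ 2) * ((M * ‖w‖) ^ 2 * (4 * Real.exp ‖w‖))) ?_ ?_ ?_
    · apply Summable.mul_right
      have := (summable_nat_add_iff 1).2 (Real.summable_one_div_nat_pow (p := 2) |>.2 (by norm_num))
      simpa using this
    · intro j
      have h1 : Tendsto (fun n => ((γ (φ n) j : ℝ) : ℂ)) atTop (𝓝 (δ j : ℂ)) :=
        (Complex.continuous_ofReal.tendsto _).comp (hδ j)
      have hc : Continuous fun x : ℂ => (1 + x * w) * Complex.exp (-(x * w)) - 1 := by fun_prop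
      exact (hc.tendsto _).comp h1
    · refine Eventually.of_forall fun n j => (norm_weierstrass_le _).trans ?_
      have hn : ‖(γ (φ n) j : ℂ) * w‖ = γ (φ n) j * ‖w‖ := by
        rw [norm_mul, Complex.norm_real, Real.norm_of_nonneg (hb _ j).1]
      rw [hn]
      have h0 := (hb (φ n) j).1
      have h1 := (hb (φ n) j).2
      have h2 := hγM (φ n) j
      have h3 : γ (φ n) j * ‖w‖ ≤ ‖w‖ := mul_le_of_le_one_left (norm_nonneg _) h1
      calc (γ (φ n) j * ‖w‖) ^ 2 * (4 * Real.exp (γ (φ n) j * ‖w‖))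
          ≤ (M / (j + 1) * ‖w‖) ^ 2 * (4 * Real.exp ‖w‖) := by gcongr
        _ = _ := by field_simp
  have hexp : Tendsto (fun n => Complex.exp ((S (φ n) : ℂ) * w)) atTop
      (𝓝 (Complex.exp ((T : ℂ) * w))) := by
    have hc : Continuous fun x : ℝ => Complex.exp ((x : ℂ) * w) := by fun_prop
    exact (hc.tendsto _).comp hSφ
  have hR := (((hpt 1).comp hφ.tendsto_atTop).mul hexp).mul hlimprod
  have hLft := (hpt (1 + w)).comp hφ.tendsto_atTop
  have heq : g (1 + w) = g 1 * Complex.exp ((T : ℂ) * w) *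
      ∏' j, (1 + ((1 + (δ j : ℂ) * w) * Complex.exp (-((δ j : ℂ) * w)) - 1)) := by
    refine tendsto_nhds_unique hLft (hR.congr (fun n => ?_))
    simp only [Function.comp]
    rw [hfin (φ n)]
  rw [heq]
  have hcs : Summable fun j => -((δ j : ℂ) * w) :=
    ((Complex.hasSum_ofReal.2 hδs.hasSum).summable.mul_right w).neg
  have hprodexp : HasProd (fun j => Complex.exp (-((δ j : ℂ) * w)))
      (Complex.exp (∑' j, -((δ j : ℂ) * w))) := hcs.hasSum.cexp
  have hm1 : Multipliable fun j => (1 + (δ j : ℂ) * w) := by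
    apply multipliable_one_add_of_summable
    refine (hδs.mul_right ‖w‖).congr (fun j => ?_)
    rw [norm_mul, Complex.norm_real, Real.norm_of_nonneg (hδb j).1]
  have h1 : ∏' j, (1 + ((1 + (δ j : ℂ) * w) * Complex.exp (-((δ j : ℂ) * w)) - 1)) =
      (∏' j, (1 + (δ j : ℂ) * w)) * Complex.exp (∑' j, -((δ j : ℂ) * w)) := by
    rw [← hprodexp.tprod_eq, ← hm1.tprod_mul hprodexp.multipliable]
    refine tprod_congr fun j => ?_
    ring
  have h2 : ∑' j, -((δ j : ℂ) * w) = -((∑' j, δ j : ℝ) : ℂ) * w := by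
    rw [tsum_neg, tsum_mul_right, Complex.ofReal_tsum]
    ring
  rw [h1, h2]
  have h3 : ((T - ∑' j, δ j : ℝ) : ℂ) * w = (T : ℂ) * w + -((∑' j, δ j : ℝ) : ℂ) * w := by
    push_cast; ring
  rw [h3, Complex.exp_add]
  ring

lemma tendsto_seq_locally {a : ℕ → ℂ} {b : ℂ} (h : Tendsto a atTop (𝓝 b)) :
    TendstoLocallyUniformly (fun (n : ℕ) (_ : ℂ) => a n) (fun _ => b) atTop := by
  intro u hu x
  refine ⟨Set.univ, univ_mem, ?_⟩
  filter_upwards [h.eventually (UniformSpace.ball_mem_nhds b hu)] with n hn y _ using hn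

theorem stmt_15 (κ θ : ℝ) (hκ : 0 ≤ κ) (hθ : 0 ≤ θ) (f : ℂ → ℂ)
    (hf : LaguerrePlus f) :
    LaguerrePlus (fun z => (κ : ℂ) * f z + (θ : ℂ) * deriv f z + z * deriv (deriv f) z) := by
  obtain ⟨c, l, α, β, hα, hβ, -, hs, hfz⟩ := hf
  by_cases hc : c = 0
  · have hf0 : f = fun _ => 0 := by
      funext z; rw [hfz z, hc]; simp
    refine ⟨0, 0, 0, 0, le_rfl, fun _ => le_rfl, fun _ => le_rfl, summable_zero, fun z => ?_⟩
    simp [hf0]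
  obtain ⟨P, hP, hlim⟩ := exists_approx c hc l α hα β hβ hs
  rw [← funext hfz] at hlim
  have step : ∀ (P : ℕ → ℂ[X]) (h : ℂ → ℂ),
      TendstoLocallyUniformly (fun n z => (P n).eval z) h atTop →
      Continuous h ∧
      TendstoLocallyUniformly (fun n z => (derivative (P n)).eval z) (deriv h) atTop := by
    intro P h hl
    refine ⟨hl.continuous (Eventually.of_forall fun n => (P n).continuous).frequently, ?_⟩
    have hd : ∀ n, DifferentiableOn ℂ (fun z => (P n).eval z) Set.univ := fun n =>
      (P n).differentiable.differentiableOn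
    have := (tendstoLocallyUniformlyOn_univ.2 hl).deriv (Eventually.of_forall hd) isOpen_univ
    refine (tendstoLocallyUniformlyOn_univ.1 this).congr (fun n z => ?_)
    simp [Polynomial.deriv]
  obtain ⟨hc0, hl1⟩ := step P f hlim
  obtain ⟨hc1, hl2⟩ := step _ _ hl1
  obtain ⟨hc2, -⟩ := step _ _ hl2
  have hκn : ∀ n : ℕ, 0 < κ + 1 / ((n : ℝ) + 1) := fun n => by positivity
  refine laguerrePlus_of_limit
    (fun n => C ((κ + 1 / ((n : ℝ) + 1) : ℝ) : ℂ) * P n + C (θ : ℂ) * derivative (P n) +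
      X * derivative (derivative (P n)))
    (fun n => negRoots_kappa_delta (hP n) (hκn n) hθ) _ ?_
  have hk : Tendsto (fun n : ℕ => ((κ + 1 / ((n : ℝ) + 1) : ℝ) : ℂ)) atTop (𝓝 (κ : ℂ)) := by
    have h1 : Tendsto (fun n : ℕ => κ + 1 / ((n : ℝ) + 1)) atTop (𝓝 (κ + 0)) :=
      tendsto_one_div_add_atTop_nhds_zero_nat.const_add κ
    rw [add_zero] at h1
    exact (Complex.continuous_ofReal.tendsto _).comp h1
  have hX : TendstoLocallyUniformly (fun (_ : ℕ) (z : ℂ) => z) (fun z => z) atTop := by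
    intro u hu x
    exact ⟨Set.univ, univ_mem, Eventually.of_forall fun n y _ => refl_mem_uniformity hu⟩
  have t1 := (tendsto_seq_locally hk).mul₀ hlim continuous_const hc0
  have t2 := (tendsto_seq_locally (tendsto_const_nhds (x := (θ : ℂ)))).mul₀ hl1
    continuous_const hc1
  have t3 := hX.mul₀ hl2 continuous_id hc2
  refine ((t1.add t2).add t3).congr (fun n z => ?_)
  simp
end

section
/- Let θ > 0, a > 0 and b ≥ 0 with ab < 1, and let f ∈ A_b. Then for every z ∈ ℂ the integral ∫_0^∞ s^{θ−1} e^{−s} w_θ(sz/a) f(as) ds converges, and (exp(aΔ_θ)f)(z) = e^{−z/a} ∫_0^∞ s^{θ−1} e^{−s} w_θ(sz/a) f(as) ds. -/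
open Filter Topology MeasureTheory
open scoped ENNReal

/-- `q_θ^{(m,k)} = ∏_{l=0}^{k-1} (m-l)(θ+m-1-l)` for `k ≤ m`, and `0` for `k > m`. -/
noncomputable def qTheta (θ : ℝ) (m k : ℕ) : ℝ :=
  if k ≤ m then ∏ l ∈ Finset.range k, ((m - l : ℝ) * (θ + m - 1 - l)) else 0

/-- `exp(aΔ_θ)f`, i.e. `φ_a(Δ_θ)f` with `φ_a(z) = e^{az}` (so `φ_a^{(k)}(0) = a^k`):
the function with Taylor coefficients
`g^{(n)}(0) = Σ_k (n!/(k!(n+k)!)) a^k f^{(n+k)}(0) q_θ^{(n+k,k)}`. -/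
noncomputable def expDelta (θ a : ℝ) (f : ℂ → ℂ) : ℂ → ℂ := fun z =>
  ∑' n : ℕ,
    (∑' k : ℕ, ((n.factorial : ℂ) / ((k.factorial : ℂ) * ((n + k).factorial : ℂ))) *
      (a : ℂ) ^ k * iteratedDeriv (n + k) f 0 * (qTheta θ (n + k) k : ℂ)) *
      z ^ n / (n.factorial : ℂ)

/-- `w_θ(z) = Σ_k z^k / (k! Γ(θ+k))`. -/
noncomputable def wTheta (θ : ℝ) (z : ℂ) : ℂ :=
  ∑' k : ℕ, z ^ k / ((k.factorial : ℂ) * (Real.Gamma (θ + k) : ℂ))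

/-- rising factorial -/
noncomputable def rp (x : ℝ) (k : ℕ) : ℝ := ∏ i ∈ Finset.range k, (x + i)

lemma rp_nonneg {x : ℝ} (hx : 0 ≤ x) (k : ℕ) : 0 ≤ rp x k :=
  Finset.prod_nonneg fun i _ => by positivity

lemma rp_mono {x y : ℝ} (hx : 0 ≤ x) (h : x ≤ y) (k : ℕ) : rp x k ≤ rp y k :=
  Finset.prod_le_prod (fun i _ => by positivity) fun i _ => by linarith

lemma Gamma_rp {x : ℝ} (hx : 0 < x) (k : ℕ) : Real.Gamma (x + k) = rp x k * Real.Gamma x := by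
  induction k with
  | zero => simp [rp]
  | succ k ih =>
    have : x + k ≠ 0 := by positivity
    rw [Nat.cast_succ, ← add_assoc, Real.Gamma_add_one this, ih, rp, rp, Finset.prod_range_succ]
    ring

lemma rp_reflect (x : ℝ) (k : ℕ) : ∏ l ∈ Finset.range k, (x + k - 1 - l) = rp x k := by
  rw [rp, ← Finset.prod_range_reflect]
  refine Finset.prod_congr rfl fun i hi => ?_
  have := Finset.mem_range.1 hi
  rw [Nat.sub_sub, Nat.cast_sub (by omega)]
  push_cast; ring

lemma rp_natCast (N k : ℕ) : rp ((N : ℝ) + 1) k = (k.factorial : ℝ) * ((k + N).choose N : ℝ) := by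
  induction k with
  | zero => simp [rp]
  | succ k ih =>
    rw [rp, Finset.prod_range_succ, ← rp, ih, Nat.factorial_succ]
    have h1 := Nat.add_one_mul_choose_eq (k + N) k
    have e1 : (k + N).choose N = (k + N).choose k := by
      rw [← Nat.choose_symm_add]
    have e2 : (k + 1 + N).choose N = (k + N + 1).choose (k + 1) := by
      rw [show k + N + 1 = k + 1 + N by ring, ← Nat.choose_symm_add]
    rw [e1, e2]
    have h2 : ((k + N + 1 : ℕ) : ℝ) * ((k + N).choose k : ℝ) = ((k + N + 1).choose (k + 1) : ℝ) * ((k + 1 : ℕ) : ℝ) := by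
      exact_mod_cast h1
    push_cast at h2 ⊢
    linear_combination (k.factorial : ℝ) * h2

lemma qTheta_eq (θ : ℝ) (n k : ℕ) :
    qTheta θ (n + k) k = ((n + k).factorial : ℝ) / (n.factorial : ℝ) * rp (θ + n) k := by
  rw [qTheta, if_pos (by omega), Finset.prod_mul_distrib, ← rp_reflect]
  congr 1
  · have h := rp_reflect ((n : ℝ) + 1) k
    rw [rp_natCast] at h
    have : ∏ l ∈ Finset.range k, (((n + k : ℕ) : ℝ) - l) = ∏ l ∈ Finset.range k, ((n : ℝ) + 1 + k - 1 - l) := by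
      refine Finset.prod_congr rfl fun i _ => ?_
      push_cast; ring
    rw [this, h]
    have h3 := Nat.add_choose_mul_factorial_mul_factorial k n
    have hn : (n.factorial : ℝ) ≠ 0 := by positivity
    rw [eq_div_iff hn, add_comm n k, ← h3, ← Nat.choose_symm_add]
    push_cast; ring
  · refine Finset.prod_congr rfl fun i _ => ?_
    push_cast; ring

lemma asc_eval_eq (y : ℝ) (j : ℕ) : (ascPochhammer ℝ j).eval y = rp y j := by
  induction j with
  | zero => simp [rp]
  | succ j ih => rw [ascPochhammer_succ_eval, ih, rp, rp, Finset.prod_range_succ]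

lemma rp_vandermonde (x : ℝ) (k m : ℕ) :
    rp (x + k) m / (m.factorial : ℝ) = ∑ p ∈ Finset.HasAntidiagonal.antidiagonal m,
      (k.choose p.1 : ℝ) * (rp (x + p.1) p.2 / (p.2.factorial : ℝ)) := by
  have key (y : ℝ) (j : ℕ) : rp y j / (j.factorial : ℝ) = Ring.choose (y + j - 1) j := by
    rw [Ring.choose_eq_smul, Polynomial.descPochhammer_smeval_eq_ascPochhammer,
      Polynomial.ascPochhammer_smeval_eq_eval, asc_eval_eq]
    rw [smul_eq_mul, div_eq_inv_mul]
    congr 2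
    ring
  rw [key, show x + k + m - 1 = (k : ℝ) + (x + m - 1) by ring, Ring.add_choose_eq m (Commute.all _ _)]
  refine Finset.sum_congr rfl fun p hp => ?_
  rw [key, Ring.choose_natCast, ← Finset.HasAntidiagonal.mem_antidiagonal.1 hp]
  congr 2
  push_cast; ring

lemma hasSum_exp_choose (x : ℂ) (n : ℕ) :
    HasSum (fun k : ℕ => x ^ k / (k.factorial : ℂ) * (k.choose n : ℂ))
      (x ^ n / (n.factorial : ℂ) * Complex.exp x) := by
  have h : HasSum (fun k : ℕ => x ^ k / (k.factorial : ℂ)) (Complex.exp x) := by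
    rw [Complex.exp_eq_exp_ℂ]
    exact NormedSpace.expSeries_div_hasSum_exp x
  rw [← hasSum_nat_add_iff' n, Finset.sum_eq_zero, sub_zero]
  · convert! h.mul_left (x ^ n / (n.factorial : ℂ)) using 2 with k
    have h3 := Nat.add_choose_mul_factorial_mul_factorial k n
    have h4 : ((k + n).choose n : ℂ) * k.factorial * n.factorial = (k + n).factorial := by
      exact_mod_cast h3
    have h5 : ((k + n).factorial : ℂ) ≠ 0 := by exact_mod_cast Nat.factorial_ne_zero _
    have h6 : (k.factorial : ℂ) ≠ 0 := by exact_mod_cast Nat.factorial_ne_zero _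
    have h7 : (n.factorial : ℂ) ≠ 0 := by exact_mod_cast Nat.factorial_ne_zero _
    field_simp
    rw [pow_add]
    linear_combination x ^ k * x ^ n * h4
  · intro i hi
    rw [Nat.choose_eq_zero_of_lt (Finset.mem_range.1 hi)]; simp

lemma summable_of_iter (F : ℕ → ℕ → ℝ) (G : ℕ → ℝ) (hF : ∀ n k, 0 ≤ F n k)
    (h : ∀ n, HasSum (F n) (G n)) (hG : Summable G) :
    Summable (fun p : ℕ × ℕ => F p.1 p.2) := by
  refine (summable_prod_of_nonneg (fun p => hF p.1 p.2)).2 ⟨fun n => (h n).summable, ?_⟩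
  have : (fun n => ∑' k, F n k) = G := funext fun n => (h n).tsum_eq
  simpa only [this] using hG

lemma summable_M1 {t y : ℝ} (N : ℕ) (ht : 0 ≤ t) (ht1 : t < 1) (hy : 0 ≤ y) :
    Summable (fun p : ℕ × ℕ => y ^ p.1 / (p.1.factorial : ℝ) *
      (((p.2 + (N + p.1)).choose (N + p.1) : ℝ) * t ^ p.2)) := by
  have h1t : 0 < 1 - t := by linarith
  have h3 : (fun n : ℕ => y ^ n / (n.factorial : ℝ) * (1 / (1 - t) ^ (N + n + 1))) =
      fun n : ℕ => (1 / (1 - t) ^ (N + 1)) * ((y / (1 - t)) ^ n / (n.factorial : ℝ)) := by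
    funext n
    have h6 : (1 - t) ^ (N + n + 1) = (1 - t) ^ n * (1 - t) ^ (N + 1) := by ring
    rw [div_pow, h6]
    field_simp
  refine summable_of_iter (fun n k => y ^ n / (n.factorial : ℝ) *
      (((k + (N + n)).choose (N + n) : ℝ) * t ^ k))
      (fun n : ℕ => y ^ n / (n.factorial : ℝ) * (1 / (1 - t) ^ (N + n + 1))) ?_ ?_ ?_
  · intro n k
    have h1 : 0 ≤ y ^ n := pow_nonneg hy _
    have h2 : 0 ≤ t ^ k := pow_nonneg ht _
    exact mul_nonneg (div_nonneg h1 (Nat.cast_nonneg _)) (mul_nonneg (Nat.cast_nonneg _) h2)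
  · intro n
    have htn : ‖t‖ < 1 := by rwa [Real.norm_of_nonneg ht]
    have h8 := hasSum_choose_mul_geometric_of_norm_lt_one (𝕜 := ℝ) (r := t) (N + n) htn
    exact h8.mul_left (y ^ n / (n.factorial : ℝ))
  · rw [h3]
    exact (Real.summable_pow_div_factorial (y / (1 - t))).mul_left (1 / (1 - t) ^ (N + 1))

lemma bound_M {θ t y : ℝ} (N : ℕ) (hN : θ ≤ N) (hθ : 0 < θ) (ht : 0 ≤ t) (hy : 0 ≤ y) (n k : ℕ) :
    t ^ k * rp (θ + n) k * y ^ n / ((k.factorial : ℝ) * (n.factorial : ℝ)) ≤ y ^ n / (n.factorial : ℝ) *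
      (((k + (N + n)).choose (N + n) : ℝ) * t ^ k) := by
  have h := rp_mono (x := θ + n) (y := ((N + n : ℕ) : ℝ) + 1) (by positivity)
    (by push_cast; linarith) k
  rw [rp_natCast] at h
  generalize ((k + (N + n)).choose (N + n) : ℝ) = c at *
  calc _ ≤ t ^ k * ((k.factorial : ℝ) * c) * y ^ n /
      ((k.factorial : ℝ) * (n.factorial : ℝ)) := by gcongr
      _ = _ := by
        have : (k.factorial : ℝ) ≠ 0 := by positivity
        field_simp

lemma summable_M {θ t y : ℝ} (hθ : 0 < θ) (ht : 0 ≤ t) (ht1 : t < 1) (hy : 0 ≤ y) :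
    Summable (fun p : ℕ × ℕ => t ^ p.2 * rp (θ + p.1) p.2 * y ^ p.1 /
      ((p.2.factorial : ℝ) * (p.1.factorial : ℝ))) := by
  obtain ⟨N, hN⟩ := exists_nat_ge θ
  refine (summable_M1 N ht ht1 hy).of_nonneg_of_le (fun p => ?_)
    (fun p => bound_M N hN hθ ht hy p.1 p.2)
  have := rp_nonneg (x := θ + p.1) (by positivity) p.2
  positivity

lemma integrable_tsum' {α ι : Type*} [MeasurableSpace α] {μ : Measure α} [Countable ι]
    {F : ι → α → ℂ} {g : α → ℂ}
    (hF_int : ∀ i : ι, Integrable (F i) μ) (hF_sum : Summable fun i ↦ ∫ a, ‖F i a‖ ∂μ)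
    (h : ∀ᵐ a ∂μ, HasSum (fun i => F i a) (g a)) : Integrable g μ := by
  have hg : AEStronglyMeasurable g μ :=
    aestronglyMeasurable_of_tendsto_ae (u := (atTop : Filter (Finset ι)))
      (f := fun s a => ∑ i ∈ s, F i a)
      (fun s => Finset.aestronglyMeasurable_fun_sum s fun i _ => (hF_int i).1) h
  refine ⟨hg, ?_⟩
  have h1 : ∫⁻ a, ∑' i, ‖F i a‖ₑ ∂μ < ⊤ := by
    rw [lintegral_tsum (fun i => (hF_int i).1.enorm)]
    have (i : ι) : ∫⁻ a, ‖F i a‖ₑ ∂μ = ENNReal.ofReal (∫ a, ‖F i a‖ ∂μ) := by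
      rw [ofReal_integral_norm_eq_lintegral_enorm (hF_int i)]
    simp_rw [this]
    exact hF_sum.tsum_ofReal_lt_top
  refine lt_of_le_of_lt (lintegral_mono_ae ?_) h1
  filter_upwards [h] with a ha
  rw [← ha.tsum_eq]
  exact enorm_tsum_le_tsum_enorm

lemma exists_bound {β : ℝ} (hβ : 0 < β) {f : ℂ → ℂ} (h : normB β f < ⊤) :
    ∃ C : ℝ, 0 ≤ C ∧ ∀ k, ‖iteratedDeriv k f 0‖ ≤ C * β ^ k := by
  refine ⟨(normB β f).toReal, ENNReal.toReal_nonneg, fun k => ?_⟩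
  have h1 : ENNReal.ofReal (‖iteratedDeriv k f 0‖ / β ^ k) ≤ normB β f :=
    le_iSup (fun k : ℕ => ENNReal.ofReal (‖iteratedDeriv k f 0‖ / β ^ k)) k
  have h2 := (ENNReal.ofReal_le_iff_le_toReal h.ne).1 h1
  rwa [div_le_iff₀ (by positivity)] at h2

lemma summable_wTheta {θ : ℝ} (hθ : 0 < θ) (u : ℂ) :
    Summable (fun k : ℕ => u ^ k / ((k.factorial : ℂ) * (Real.Gamma (θ + k) : ℂ))) := by
  have hG := Real.Gamma_pos_of_pos hθ
  refine Summable.of_norm_bounded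
    ((Real.summable_pow_div_factorial (‖u‖ / θ)).mul_left (1 / Real.Gamma θ)) fun k => ?_
  have h1 : θ ^ k ≤ rp θ k := by
    have : θ ^ k = ∏ i ∈ Finset.range k, θ := by simp
    rw [this, rp]
    exact Finset.prod_le_prod (fun _ _ => hθ.le) fun i _ => by
      have : (0 : ℝ) ≤ i := Nat.cast_nonneg i
      linarith
  have h2 : 0 < θ ^ k := by positivity
  rw [Gamma_rp hθ, norm_div, norm_mul, norm_pow, Complex.norm_natCast, Complex.norm_real,
    Real.norm_of_nonneg (by have := h2.trans_le h1; positivity), div_pow]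
  calc ‖u‖ ^ k / ((k.factorial : ℝ) * (rp θ k * Real.Gamma θ))
      ≤ ‖u‖ ^ k / ((k.factorial : ℝ) * (θ ^ k * Real.Gamma θ)) := by gcongr
    _ = _ := by
      have : (k.factorial : ℝ) ≠ 0 := by positivity
      field_simp

/-- terms of the double series for the integral -/
noncomputable def TT (θ a : ℝ) (x : ℂ) (c : ℕ → ℂ) (p : ℕ × ℕ) : ℂ :=
  c p.2 * (a : ℂ) ^ p.2 * (x ^ p.1 / (p.1.factorial : ℂ)) *
    ((rp (θ + p.1) p.2 / (p.2.factorial : ℝ) : ℝ) : ℂ)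

/-- terms of the double series for the operator exponential -/
noncomputable def UU (θ a : ℝ) (x : ℂ) (c : ℕ → ℂ) (p : ℕ × ℕ) : ℂ :=
  c (p.1 + p.2) * (a : ℂ) ^ (p.1 + p.2) * (x ^ p.1 / (p.1.factorial : ℂ)) *
    ((rp (θ + p.1) p.2 / (p.2.factorial : ℝ) : ℝ) : ℂ)

section
variable {θ a β C : ℝ} {x : ℂ} {c : ℕ → ℂ}

lemma summable_TT (hθ : 0 < θ) (ha : 0 < a) (hβ : 0 < β) (hab : a * β < 1)
    (hc : ∀ k, ‖c k‖ ≤ C * β ^ k) : Summable (TT θ a x c) := by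
  refine Summable.of_norm_bounded ((summable_M (θ := θ) (t := a * β) (y := ‖x‖) hθ (by positivity)
    hab (norm_nonneg _)).mul_left C) fun p => ?_
  have h0 := rp_nonneg (x := θ + p.1) (by positivity) p.2
  rw [TT, norm_mul, norm_mul, norm_mul, norm_div, norm_pow, norm_pow, Complex.norm_real,
    Complex.norm_real, Real.norm_of_nonneg ha.le, Complex.norm_natCast,
    Real.norm_of_nonneg (by positivity)]
  calc _ ≤ (C * β ^ p.2) * a ^ p.2 * (‖x‖ ^ p.1 / (p.1.factorial : ℝ)) *
        (rp (θ + p.1) p.2 / (p.2.factorial : ℝ)) := by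
        gcongr
        exact hc _
    _ = _ := by
      rw [mul_pow]
      field_simp

lemma summable_UU (hθ : 0 < θ) (ha : 0 < a) (hβ : 0 < β) (hab : a * β < 1)
    (hc : ∀ k, ‖c k‖ ≤ C * β ^ k) : Summable (UU θ a x c) := by
  refine Summable.of_norm_bounded ((summable_M (θ := θ) (t := a * β) (y := a * β * ‖x‖) hθ
    (by positivity) hab (by positivity)).mul_left C) fun p => ?_
  have h0 := rp_nonneg (x := θ + p.1) (by positivity) p.2
  rw [UU, norm_mul, norm_mul, norm_mul, norm_div, norm_pow, norm_pow, Complex.norm_real,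
    Complex.norm_real, Real.norm_of_nonneg ha.le, Complex.norm_natCast,
    Real.norm_of_nonneg (by positivity)]
  calc _ ≤ (C * β ^ (p.1 + p.2)) * a ^ (p.1 + p.2) * (‖x‖ ^ p.1 / (p.1.factorial : ℝ)) *
        (rp (θ + p.1) p.2 / (p.2.factorial : ℝ)) := by
        gcongr
        exact hc _
    _ = _ := by
      rw [mul_pow, mul_pow, mul_pow, pow_add, pow_add]
      field_simp

lemma tsum_TT (hθ : 0 < θ) (ha : 0 < a) (hβ : 0 < β) (hab : a * β < 1)
    (hc : ∀ k, ‖c k‖ ≤ C * β ^ k) :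
    ∑' p, TT θ a x c p = Complex.exp x * ∑' p, UU θ a x c p := by
  have hT := summable_TT (x := x) hθ ha hβ hab hc
  have hU := (summable_UU (x := x) hθ ha hβ hab hc).hasSum
  have h1 : HasSum (fun q : Σ n : ℕ, Finset.HasAntidiagonal.antidiagonal n => UU θ a x c q.2)
      (∑' p, UU θ a x c p) :=
    (Finset.HasAntidiagonal.sigmaAntidiagonalEquivProd.hasSum_iff).2 hU
  have h2 : HasSum (fun m : ℕ => ∑ p ∈ Finset.HasAntidiagonal.antidiagonal m, UU θ a x c p)
      (∑' p, UU θ a x c p) := by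
    refine h1.sigma fun m => ?_
    have := hasSum_fintype (fun q : Finset.HasAntidiagonal.antidiagonal m => UU θ a x c q)
    rwa [Finset.sum_coe_sort (Finset.HasAntidiagonal.antidiagonal m) (UU θ a x c)] at this
  have h3 (m : ℕ) : HasSum (fun k => TT θ a x c (k, m))
      (Complex.exp x * ∑ p ∈ Finset.HasAntidiagonal.antidiagonal m, UU θ a x c p) := by
    have e1 (k : ℕ) : TT θ a x c (k, m) = ∑ p ∈ Finset.HasAntidiagonal.antidiagonal m,
        (c m * (a : ℂ) ^ m * ((rp (θ + p.1) p.2 / (p.2.factorial : ℝ) : ℝ) : ℂ)) *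
          (x ^ k / (k.factorial : ℂ) * (k.choose p.1 : ℂ)) := by
      simp only [TT]
      rw [rp_vandermonde, Complex.ofReal_sum, Finset.mul_sum]
      refine Finset.sum_congr rfl fun p _ => ?_
      push_cast
      ring
    simp_rw [e1]
    rw [Finset.mul_sum]
    refine hasSum_sum fun p hp => ?_
    have e2 : Complex.exp x * UU θ a x c p =
        (c m * (a : ℂ) ^ m * ((rp (θ + p.1) p.2 / (p.2.factorial : ℝ) : ℝ) : ℂ)) *
          (x ^ p.1 / (p.1.factorial : ℂ) * Complex.exp x) := by
      rw [UU, Finset.HasAntidiagonal.mem_antidiagonal.1 hp]; ring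
    rw [e2]
    exact (hasSum_exp_choose x p.1).mul_left _
  have h4 : HasSum (fun q : ℕ × ℕ => TT θ a x c q.swap) (∑' p, TT θ a x c p) :=
    ((Equiv.prodComm ℕ ℕ).hasSum_iff (f := TT θ a x c)).2 hT.hasSum
  have h5 := h4.prod_fiberwise h3
  exact h5.unique (h2.mul_left _)

end

lemma expDelta_eq {θ a β C : ℝ} {f : ℂ → ℂ} (z : ℂ) (hθ : 0 < θ) (ha : 0 < a) (hβ : 0 < β)
    (hab : a * β < 1) (hc : ∀ k, ‖iteratedDeriv k f 0‖ ≤ C * β ^ k) :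
    expDelta θ a f z = ∑' p, UU θ a (z / a) (fun k => iteratedDeriv k f 0) p := by
  rw [(summable_UU (x := z / a) hθ ha hβ hab hc).tsum_prod, expDelta]
  refine tsum_congr fun n => ?_
  rw [← tsum_mul_right, ← tsum_div_const]
  refine tsum_congr fun k => ?_
  rw [qTheta_eq, UU]
  have h5 : ((n + k).factorial : ℂ) ≠ 0 := by exact_mod_cast Nat.factorial_ne_zero _
  have h6 : (k.factorial : ℂ) ≠ 0 := by exact_mod_cast Nat.factorial_ne_zero _
  have h7 : (n.factorial : ℂ) ≠ 0 := by exact_mod_cast Nat.factorial_ne_zero _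
  have h8 : (a : ℂ) ≠ 0 := by exact_mod_cast ha.ne'
  push_cast
  rw [div_pow, pow_add]
  field_simp

/-- the terms of the integrand -/
noncomputable def FF (θ a : ℝ) (z : ℂ) (c : ℕ → ℂ) (p : ℕ × ℕ) (s : ℝ) : ℂ :=
  (c p.2 * (a : ℂ) ^ p.2 / (p.2.factorial : ℂ) * ((z / a) ^ p.1 /
    ((p.1.factorial : ℂ) * (Real.Gamma (θ + p.1) : ℂ)))) *
    ((Real.exp (-s) * s ^ (θ + p.1 + p.2 - 1) : ℝ) : ℂ)

lemma FF_integrable {θ : ℝ} (a : ℝ) (z : ℂ) (c : ℕ → ℂ) (hθ : 0 < θ) (p : ℕ × ℕ) :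
    IntegrableOn (FF θ a z c p) (Set.Ioi 0) :=
  ((Real.GammaIntegral_convergent (s := θ + p.1 + p.2) (by positivity)).ofReal).const_mul _

lemma FF_integral {θ : ℝ} (a : ℝ) (z : ℂ) (c : ℕ → ℂ) (hθ : 0 < θ) (p : ℕ × ℕ) :
    ∫ s in Set.Ioi 0, FF θ a z c p s = TT θ a (z / a) c p := by
  have hG : (Real.Gamma (θ + p.1) : ℂ) ≠ 0 := by
    exact_mod_cast (Real.Gamma_pos_of_pos (by positivity : 0 < θ + p.1)).ne'
  simp only [FF]
  rw [integral_const_mul, integral_complex_ofReal,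
    ← Real.Gamma_eq_integral (by positivity : 0 < θ + p.1 + p.2), Gamma_rp (x := θ + p.1) (by positivity), TT]
  push_cast
  field_simp

lemma FF_integral_norm {θ : ℝ} (a : ℝ) (z : ℂ) (c : ℕ → ℂ) (hθ : 0 < θ) (p : ℕ × ℕ) :
    ∫ s in Set.Ioi 0, ‖FF θ a z c p s‖ = ‖TT θ a (z / a) c p‖ := by
  rw [← FF_integral a z c hθ]
  simp only [FF]
  have : ∀ s ∈ Set.Ioi (0 : ℝ), ‖((Real.exp (-s) * s ^ (θ + p.1 + p.2 - 1) : ℝ) : ℂ)‖ =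
      Real.exp (-s) * s ^ (θ + p.1 + p.2 - 1) := fun s hs => by
    have hs' : 0 < s := hs
    rw [Complex.norm_real, Real.norm_of_nonneg (by positivity)]
  simp_rw [norm_mul]
  rw [integral_const_mul, integral_const_mul, setIntegral_congr_fun measurableSet_Ioi this,
    norm_mul, norm_mul, integral_complex_ofReal, Complex.norm_real, Real.norm_of_nonneg
      (setIntegral_nonneg measurableSet_Ioi fun s hs => ?_)]
  have hs' : 0 < s := hs
  positivity

lemma hasSum_prod_aux {u v : ℕ → ℂ} {U V : ℂ} (hu : HasSum u U) (hv : HasSum v V) (w : ℂ) :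
    HasSum (fun p : ℕ × ℕ => w * u p.1 * v p.2) (w * U * V) := by
  have h1 : HasSum (fun k => w * u k) (w * U) := hu.mul_left w
  have h2 : Summable (fun p : ℕ × ℕ => (fun k => w * u k) p.1 * v p.2) :=
    summable_mul_of_summable_norm (f := fun k => w * u k) (g := v) h1.summable.norm hv.summable.norm
  exact HasSum.mul (f := fun k => w * u k) (g := v) h1 hv h2

lemma FF_hasSum {θ a : ℝ} (z : ℂ) {f : ℂ → ℂ} (hf : Differentiable ℂ f) (hθ : 0 < θ)
    (s : ℝ) (hs : 0 < s) :
    HasSum (fun p => FF θ a z (fun k => iteratedDeriv k f 0) p s)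
      (((s ^ (θ - 1) * Real.exp (-s) : ℝ) : ℂ) * wTheta θ ((s : ℂ) * z / a) *
          f ((a : ℂ) * s)) := by
  have h1 := summable_wTheta hθ ((s : ℂ) * z / a)
  have h2 : HasSum (fun n : ℕ => (n.factorial : ℂ)⁻¹ * (((a : ℂ) * s) ^ n * iteratedDeriv n f 0))
      (f ((a : ℂ) * s)) := by
    have := Complex.hasSum_taylorSeries_of_entire hf 0 ((a : ℂ) * s)
    simpa only [smul_eq_mul, sub_zero] using this
  have h1' : HasSum (fun k : ℕ => ((s : ℂ) * z / a) ^ k /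
      ((k.factorial : ℂ) * (Real.Gamma (θ + k) : ℂ))) (wTheta θ ((s : ℂ) * z / a)) := h1.hasSum
  have h4 := hasSum_prod_aux h1' h2 ((s ^ (θ - 1) * Real.exp (-s) : ℝ) : ℂ)
  have e2 : (fun p => FF θ a z (fun k => iteratedDeriv k f 0) p s) = fun p : ℕ × ℕ =>
      ((s ^ (θ - 1) * Real.exp (-s) : ℝ) : ℂ) * (((s : ℂ) * z / a) ^ p.1 /
      ((p.1.factorial : ℂ) * (Real.Gamma (θ + p.1) : ℂ))) *
      ((p.2.factorial : ℂ)⁻¹ * (((a : ℂ) * s) ^ p.2 * iteratedDeriv p.2 f 0)) := by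
    funext p
    have e : s ^ (θ + p.1 + p.2 - 1) = s ^ (θ - 1) * s ^ p.1 * s ^ p.2 := by
      rw [show θ + p.1 + p.2 - 1 = θ - 1 + p.1 + p.2 by ring, Real.rpow_add hs, Real.rpow_add hs,
        Real.rpow_natCast, Real.rpow_natCast]
    rw [FF, e, Complex.ofReal_mul, Complex.ofReal_mul, Complex.ofReal_mul, Complex.ofReal_mul,
      Complex.ofReal_pow, Complex.ofReal_pow, mul_pow, div_pow, div_pow, mul_pow]
    ring
  rw [e2]
  exact h4

theorem stmt_16 (θ a b : ℝ) (hθ : 0 < θ) (ha : 0 < a) (hb : 0 ≤ b) (hab : a * b < 1)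
    (f : ℂ → ℂ) (hf : InA b f) :
    ∀ z : ℂ,
      IntegrableOn
        (fun s : ℝ => ((s ^ (θ - 1) * Real.exp (-s) : ℝ) : ℂ) * wTheta θ ((s : ℂ) * z / a) *
          f ((a : ℂ) * s)) (Set.Ioi 0) ∧
      expDelta θ a f z = Complex.exp (-z / a) *
        ∫ s in Set.Ioi (0 : ℝ),
          ((s ^ (θ - 1) * Real.exp (-s) : ℝ) : ℂ) * wTheta θ ((s : ℂ) * z / a) *
            f ((a : ℂ) * s) := by
  intro z
  obtain ⟨β, hbβ, hβ1⟩ : ∃ β, b < β ∧ β < 1 / a :=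
    exists_between (by rw [lt_div_iff₀ ha]; linarith)
  have hβ : 0 < β := hb.trans_lt hbβ
  have haβ : a * β < 1 := by rw [lt_div_iff₀ ha] at hβ1; linarith
  obtain ⟨C, -, hC⟩ := exists_bound hβ (hf.2 β hbβ)
  have hsum : Summable fun p => ∫ s in Set.Ioi (0 : ℝ),
      ‖FF θ a z (fun k => iteratedDeriv k f 0) p s‖ := by
    simp_rw [FF_integral_norm a z _ hθ]
    exact (summable_TT hθ ha hβ haβ hC).norm
  have hae := ae_restrict_of_forall_mem (μ := volume) (measurableSet_Ioi (a := (0 : ℝ)))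
    (fun s hs => FF_hasSum (a := a) z hf.1 hθ s hs)
  refine ⟨integrable_tsum' (FF_integrable a z _ hθ) hsum hae, ?_⟩
  have h1 := integral_tsum_of_summable_integral_norm (FF_integrable a z _ hθ) hsum
  rw [expDelta_eq z hθ ha hβ haβ hC,
    integral_congr_ae (hae.mono fun s hs => hs.tsum_eq.symm), ← h1]
  simp_rw [FF_integral a z _ hθ]
  rw [tsum_TT hθ ha hβ haβ hC, ← mul_assoc, ← Complex.exp_add, neg_div, neg_add_cancel,
    Complex.exp_zero, one_mul]
end
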